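/- arXiv:2509.07765 — 6 statements merged into one kernel-verified Lean document; each statement's English description precedes it below -/
import Mathlib

section
/- Let p be prime and let χ be a nontrivial Dirichlet character mod p. Let A, B, J ⊆ F_p be subsets with 0 ∉ B, and for each u ∈ F_p define ν(u) = #{(x, y) ∈ A × B : x = u·y}. Then for every positive integer r, Σ_{u ∈ F_p} ν(u) · |Σ_{t ∈ J} χ(u + t)| ≤ (|A||B|)^{1 − 1/r} · (E_×(A) · E_×(B))^{1/(4r)} · (|J|^{2r} · 2r · √p + (2r|J|)^r · p)^{1/(2r)}. -/
open Finset

/-- The multiplicative energy of a finite subset `S` of `F_p`: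
the number of quadruples `(s₁, s₂, s₃, s₄) ∈ S⁴` with `s₁s₂ = s₃s₄`. -/
def multEnergy {p : ℕ} (S : Finset (ZMod p)) : ℕ :=
  (((S ×ˢ S) ×ˢ (S ×ˢ S)).filter (fun q => q.1.1 * q.1.2 = q.2.1 * q.2.2)).card

section

open Polynomial

theorem Polynomial.pow_sub_dvd_hasseDeriv_pow {K : Type*} [Field K] (f : K[X]) (N k : ℕ) :
    f ^ (N - k) ∣ hasseDeriv k (f ^ N) := by
  induction N generalizing k with
  | zero => simp
  | succ N ih =>
    rw [pow_succ', hasseDeriv_mul]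
    refine Finset.dvd_sum fun ij hij => ?_
    have hs := HasAntidiagonal.mem_antidiagonal.1 hij
    rcases Nat.eq_zero_or_pos ij.1 with h0 | h0
    · have h2 : ij.2 = k := by omega
      rw [h0, h2, hasseDeriv_zero']
      rcases le_or_gt k N with hk | hk
      · rw [Nat.succ_sub hk, pow_succ']
        exact mul_dvd_mul_left _ (ih k)
      · rw [show N + 1 - k = 0 by omega]; simp
    · exact Dvd.dvd.mul_left ((pow_dvd_pow f (by omega)).trans (ih ij.2)) _

theorem Polynomial.exists_linearMap_hasseDeriv_pow_mul {K : Type*} [Field K] {f : K[X]}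
    (hf : f ≠ 0) {N k : ℕ} (hk : k ≤ N) :
    ∃ Q : K[X] →ₗ[K] K[X], (∀ A, hasseDeriv k (f ^ N * A) = f ^ (N - k) * Q A) ∧
      ∀ A, (Q A).natDegree ≤ A.natDegree + k * f.natDegree := by
  choose h hh using fun i => pow_sub_dvd_hasseDeriv_pow f N i
  have hdeg : ∀ i, i ≤ N → (h i).natDegree ≤ i * f.natDegree := by
    intro i hi
    by_cases h0 : h i = 0
    · simp [h0]
    have h1 := natDegree_hasseDeriv_le (f ^ N) i
    rw [hh i, natDegree_mul (pow_ne_zero _ hf) h0, natDegree_pow, natDegree_pow] at h1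
    have h2 : N * f.natDegree = (N - i) * f.natDegree + i * f.natDegree := by
      rw [← add_mul, Nat.sub_add_cancel hi]
    omega
  refine ⟨∑ ij ∈ antidiagonal k,
    (LinearMap.mulLeft K (h ij.1 * f ^ ij.2)).comp (hasseDeriv ij.2), fun A => ?_, fun A => ?_⟩
  · rw [hasseDeriv_mul, LinearMap.sum_apply, Finset.mul_sum]
    refine Finset.sum_congr rfl fun ij hij => ?_
    have hs := HasAntidiagonal.mem_antidiagonal.1 hij
    rw [hh ij.1, show N - ij.1 = (N - k) + ij.2 by omega, pow_add]
    simp only [LinearMap.comp_apply, LinearMap.mulLeft_apply]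
    ring
  · rw [LinearMap.sum_apply]
    refine natDegree_sum_le_of_forall_le _ _ fun ij hij => ?_
    have hs := HasAntidiagonal.mem_antidiagonal.1 hij
    simp only [LinearMap.comp_apply, LinearMap.mulLeft_apply]
    have h1 := hdeg ij.1 (by omega)
    have h2 := natDegree_hasseDeriv_le A ij.2
    have h3 : k * f.natDegree = ij.1 * f.natDegree + ij.2 * f.natDegree := by rw [← add_mul, hs]
    have h4 := natDegree_pow f ij.2
    refine natDegree_mul_le.trans ?_
    have h5 := natDegree_mul_le (p := h ij.1) (q := f ^ ij.2)
    omega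

theorem Polynomial.X_sub_C_pow_dvd_of_hasseDeriv {K : Type*} [Field K] {H : K[X]} {x : K} {l : ℕ}
    (h : ∀ k < l, (hasseDeriv k H).eval x = 0) : (X - C x) ^ l ∣ H := by
  rw [X_sub_C_pow_dvd_iff, X_pow_dvd_iff]
  intro k hk
  rw [← taylor_apply, taylor_coeff, h k hk]

theorem Polynomial.X_sub_C_pow_card_dvd {K : Type*} [Field K] [Fintype K] (x : K) (f : K[X]) :
    (X - C x) ^ Fintype.card K ∣ f ^ Fintype.card K - C (f.eval x) := by
  obtain ⟨p, hp⟩ := CharP.exists K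
  have := Fact.mk (CharP.char_is_prime K p)
  obtain ⟨n, _, hn⟩ := FiniteField.card K p
  have : f ^ Fintype.card K - C (f.eval x) = (f - C (f.eval x)) ^ Fintype.card K := by
    rw [hn, sub_pow_char_pow, ← C_pow, ← hn, FiniteField.pow_card]
  rw [this]
  exact pow_dvd_pow_of_dvd (dvd_iff_isRoot.2 (by simp)) _

theorem Polynomial.coeff_zero_pow_eq_of_dvd_X_pow_sub_C {E : Type*} [Field E] {d : ℕ}
    {a : E} {G : E[X]} (hG : G.Monic) (hdvd : G ∣ X ^ d - C a) :
    (G.coeff 0) ^ d = ((-1) ^ G.natDegree) ^ d * a ^ G.natDegree := by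
  let i := algebraMap E (AlgebraicClosure E)
  have hi : Function.Injective i := i.injective
  have hs : (G.map i).Splits := IsAlgClosed.splits _
  apply hi
  have h0 := hs.coeff_zero_eq_prod_roots_of_monic (hG.map i)
  rw [coeff_map, natDegree_map] at h0
  have hpow : (G.map i).roots.prod ^ d = ((G.map i).roots.map (fun x => x ^ d)).prod := by
    rw [Multiset.prod_map_pow, Multiset.map_id']
  rw [map_pow, h0, mul_pow, hpow, map_mul, map_pow, map_pow, map_pow, map_neg,
    map_one]
  congr 1
  have hcard : (G.map i).roots.card = G.natDegree := by
    rw [← hs.natDegree_eq_card_roots, natDegree_map]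
  rw [← hcard, ← Multiset.prod_replicate]
  congr 1
  rw [Multiset.eq_replicate]
  refine ⟨by simp, fun b hb => ?_⟩
  obtain ⟨x, hx, rfl⟩ := Multiset.mem_map.1 hb
  have h1 : (G.map i) ∣ X ^ d - C (i a) := by
    have := Polynomial.map_dvd i hdvd
    simpa using this
  have h2 := (isRoot_of_mem_roots hx).dvd h1
  simpa [sub_eq_zero] using h2

theorem Polynomial.dvd_of_pow_mul_pow_eq {K : Type*} [Field K] {f : K[X]} {d : ℕ}
    (hf : f ≠ 0) (hgcd : ∀ k, (∀ x, d ∣ k * f.rootMultiplicity x) → d ∣ k)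
    {k : ℕ} {N D : K[X]} {c : K} (hc : c ≠ 0) (hN : N ≠ 0)
    (h : N ^ d * f ^ k = C c * D ^ d) : d ∣ k := by
  classical
  refine hgcd k fun x => ?_
  have h1 := congrArg (fun q : K[X] => q.roots.count x) h
  rw [roots_mul (mul_ne_zero (pow_ne_zero _ hN) (pow_ne_zero _ hf)), roots_C_mul _ hc, roots_pow,
    roots_pow, roots_pow, Multiset.count_add, Multiset.count_nsmul, Multiset.count_nsmul,
    Multiset.count_nsmul, count_roots f] at h1
  exact (Nat.dvd_add_right (Dvd.intro _ rfl)).1 (h1 ▸ Dvd.intro _ rfl)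

theorem Polynomial.isCoprime_C_mul_X_pow_sub_C {K : Type*} [Field K] {f : K[X]} {d : ℕ} (hd : 0 < d)
    (hf : f ≠ 0) (hgcd : ∀ k, (∀ x, d ∣ k * f.rootMultiplicity x) → d ∣ k)
    {c : K} (hc : c ≠ 0) {P : K[X][X]} (hP : P ≠ 0) (hPd : P.natDegree < d) :
    IsCoprime ((C f * X ^ d - C (C c)).map (algebraMap K[X] (FractionRing K[X])))
      (P.map (algebraMap K[X] (FractionRing K[X]))) := by
  set E := FractionRing K[X]
  set i := algebraMap K[X] E with hi_def
  have hi : Function.Injective i := IsFractionRing.injective K[X] E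
  have hif : i f ≠ 0 := by simpa using (map_ne_zero_iff i hi).2 hf
  have hic : i (C c) ≠ 0 := (map_ne_zero_iff i hi).2 (C_ne_zero.2 hc)
  set a : E := i (C c) / i f with ha
  have hQ : (C f * X ^ d - C (C c)).map i = C (i f) * (X ^ d - C a) := by
    simp only [Polynomial.map_sub, Polynomial.map_mul, map_C, Polynomial.map_pow, map_X, mul_sub,
      ← C_mul, ha]
    rw [mul_div_cancel₀ _ hif]
  rw [hQ, isCoprime_mul_unit_left_left (isUnit_C.2 hif.isUnit)]
  have hPm : P.map i ≠ 0 := (Polynomial.map_ne_zero_iff hi).2 hP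
  classical
  rw [← EuclideanDomain.gcd_isUnit_iff]
  set G₀ := EuclideanDomain.gcd (X ^ d - C a) (P.map i) with hG₀
  have hG₀0 : G₀ ≠ 0 := fun h => hPm (EuclideanDomain.gcd_eq_zero_iff.1 h).2
  by_contra hu
  set G := G₀ * C (G₀.leadingCoeff)⁻¹ with hG
  have hGm : G.Monic := monic_mul_leadingCoeff_inv hG₀0
  have hlc : (C (G₀.leadingCoeff)⁻¹ : E[X]) ≠ 0 :=
    C_ne_zero.2 (inv_ne_zero (leadingCoeff_ne_zero.2 hG₀0))
  have hGdeg : G.natDegree = G₀.natDegree := by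
    rw [hG, natDegree_mul hG₀0 hlc, natDegree_C, add_zero]
  have hdvd : ∀ q, G₀ ∣ q → G ∣ q := fun q hq => by
    have : IsUnit (C (G₀.leadingCoeff)⁻¹ : E[X]) :=
      isUnit_C.2 (inv_ne_zero (leadingCoeff_ne_zero.2 hG₀0)).isUnit
    exact (this.mul_right_dvd).2 hq
  have h1 := coeff_zero_pow_eq_of_dvd_X_pow_sub_C hGm
    (hdvd _ (EuclideanDomain.gcd_dvd_left _ _))
  have hlt : G.natDegree < d := by
    have := natDegree_le_of_dvd (hdvd _ (EuclideanDomain.gcd_dvd_right (X ^ d - C a) (P.map i))) hPm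
    rw [natDegree_map_eq_of_injective hi] at this
    omega
  have hpos : 0 < G.natDegree := by
    rw [hGdeg, Nat.pos_iff_ne_zero]
    intro h0
    rw [natDegree_eq_zero] at h0
    obtain ⟨x, hx⟩ := h0
    refine hu ?_
    rw [← hx]
    exact isUnit_C.2 (IsUnit.mk0 _ (fun hx0 => hG₀0 (by rw [← hx, hx0, C_0])))
  obtain ⟨N, D, hD, hND⟩ := IsFractionRing.div_surjective (A := K[X]) (G.coeff 0)
  have hD0 : D ≠ 0 := nonZeroDivisors.ne_zero hD
  have hiD : i D ≠ 0 := (map_ne_zero_iff i hi).2 hD0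
  set k := G.natDegree
  have h2 : N ^ d * f ^ k = C (((-1) ^ k) ^ d * c ^ k) * D ^ d := by
    apply hi
    rw [← hND, ha, div_pow, div_pow, ← mul_div_assoc, div_eq_div_iff (pow_ne_zero _ hiD)
      (pow_ne_zero _ hif)] at h1
    simp only [map_mul, map_pow, map_neg, map_one]
    rw [h1]
  have hc' : ((-1 : K) ^ k) ^ d * c ^ k ≠ 0 :=
    mul_ne_zero (pow_ne_zero _ (pow_ne_zero _ (neg_ne_zero.2 one_ne_zero))) (pow_ne_zero _ hc)
  have hN : N ≠ 0 := by
    rintro rfl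
    rw [zero_pow hd.ne', zero_mul] at h2
    exact mul_ne_zero (C_ne_zero.2 hc') (pow_ne_zero _ hD0) h2.symm
  exact absurd (Nat.le_of_dvd hpos (dvd_of_pow_mul_pow_eq hf hgcd hc' hN h2)) (by omega)

theorem Matrix.natDegree_det_le_sum {R n : Type*} [CommRing R] [Fintype n] [DecidableEq n]
    (A : Matrix n n R[X]) (b : n → ℕ) (h : ∀ i j, (A i j).natDegree ≤ b j) :
    A.det.natDegree ≤ ∑ j, b j := by
  rw [Matrix.det_apply]
  refine natDegree_sum_le_of_forall_le _ _ fun σ _ => ?_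
  refine (natDegree_smul_le _ _).trans ?_
  exact (natDegree_prod_le _ _).trans (Finset.sum_le_sum fun j _ => h _ _)

theorem Polynomial.eq_zero_of_dvd_eval_of_C_mul_pow_sub {K : Type*} [Field K] {f : K[X]} {d : ℕ}
    (hd : 0 < d) (hf : f ≠ 0) (hgcd : ∀ k, (∀ x, d ∣ k * f.rootMultiplicity x) → d ∣ k)
    {c : K} (hc : c ≠ 0) {M : ℕ} {W g : K[X]} {P : K[X][X]} (hPd : P.natDegree < d)
    (hPM : ∀ j, (P.coeff j).natDegree ≤ M)
    (hW : d * M + d * f.natDegree < W.natDegree) (hg : W ∣ f * g ^ d - C c) (hPg : W ∣ P.eval g) :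
    P = 0 := by
  by_contra hP
  set Q : K[X][X] := C f * X ^ d - C (C c) with hQ
  have hQd : Q.natDegree = d := by
    rw [hQ, natDegree_sub_C, natDegree_C_mul_X_pow _ _ hf]
  have hi : Function.Injective (algebraMap K[X] (FractionRing K[X])) :=
    IsFractionRing.injective K[X] _
  have hQ0 : Q ≠ 0 := by
    intro h
    rw [h, natDegree_zero] at hQd
    omega
  have hcop := isCoprime_C_mul_X_pow_sub_C hd hf hgcd hc hP hPd
  have hres : Q.resultant P d P.natDegree ≠ 0 := by
    intro h
    have h1 := resultant_map_map Q P d P.natDegree (algebraMap K[X] (FractionRing K[X]))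
    rw [h, map_zero] at h1
    have h2 : (Q.map (algebraMap K[X] (FractionRing K[X]))).resultant
      (P.map (algebraMap K[X] (FractionRing K[X]))) = 0 := by
      rw [natDegree_map_eq_of_injective hi, natDegree_map_eq_of_injective hi, hQd]
      exact h1
    exact (resultant_eq_zero_iff.1 h2).2 hcop
  obtain ⟨p, q, -, -, hpq⟩ := exists_mul_add_mul_eq_C_resultant Q P hQd.le le_rfl (Or.inl hd.ne')
  have hdvd : W ∣ Q.resultant P d P.natDegree := by
    have h1 := congrArg (eval g) hpq
    rw [eval_C, eval_add, eval_mul, eval_mul] at h1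
    rw [← h1]
    refine dvd_add (Dvd.dvd.mul_right ?_ _) (Dvd.dvd.mul_right hPg _)
    simpa [hQ] using hg
  have hle : (Q.resultant P d P.natDegree).natDegree ≤ d * M + P.natDegree * f.natDegree := by
    rw [resultant]
    refine (Matrix.natDegree_det_le_sum _
      (Fin.addCases (fun _ => M) (fun _ => f.natDegree)) ?_).trans ?_
    · intro i j
      refine Fin.addCases (fun j => ?_) (fun j => ?_) j
      · simp only [sylvester, Matrix.of_apply, Fin.addCases_left]
        split_ifs
        · exact hPM _
        · simp
      · simp only [sylvester, Matrix.of_apply, Fin.addCases_right]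
        split_ifs
        · rw [hQ, coeff_sub, coeff_C_mul, coeff_X_pow, coeff_C]
          refine (natDegree_sub_le _ _).trans (max_le ?_ ?_)
          · split_ifs <;> simp
          · split_ifs <;> simp
        · simp
    · rw [Fin.sum_univ_add]
      simp
  have h1 := natDegree_le_of_dvd hdvd hres
  have h2 : P.natDegree * f.natDegree ≤ d * f.natDegree := Nat.mul_le_mul_right _ hPd.le
  omega

theorem eq_zero_of_sum_pow_mul_eq_zero {R : Type*} [CommRing R] [IsDomain R] {W : R} (hW : W ≠ 0)
    {n : ℕ} {G : Fin n → R} (hG : ∀ i, W ∣ G i → G i = 0)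
    (h : ∑ i : Fin n, W ^ (i : ℕ) * G i = 0) (i : Fin n) : G i = 0 := by
  induction i using WellFoundedLT.induction with
  | _ i ih =>
    refine hG i ?_
    have h1 : W ^ ((i : ℕ) + 1) ∣ W ^ (i : ℕ) * G i := by
      rw [← Finset.add_sum_erase _ _ (Finset.mem_univ i)] at h
      rw [eq_neg_of_add_eq_zero_left h, dvd_neg]
      refine Finset.dvd_sum fun j hj => ?_
      rcases lt_or_gt_of_ne (Finset.ne_of_mem_erase hj) with hji | hji
      · rw [ih j hji, mul_zero]
        exact dvd_zero _
      · exact Dvd.dvd.mul_right (pow_dvd_pow _ hji) _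
    rw [pow_succ] at h1
    exact (mul_dvd_mul_iff_left (pow_ne_zero _ hW)).1 h1

theorem FiniteField.exists_auxiliary_polynomial {K : Type*} [Field K] [Fintype K]
    {f : K[X]} (hf : f ≠ 0) {d L E M m l : ℕ} (a ζ : K) (hl : l ≤ Fintype.card K)
    (hdim : l * (M + l * f.natDegree + (L + E)) < d * (L + E) * M)
    (hnon : ∀ P : K[X][X], P.natDegree < d → (∀ j, (P.coeff j).natDegree ≤ M) →
      (X - C a) ^ Fintype.card K ∣ P.eval (f ^ m) → P = 0) :
    ∃ H : K[X], H ≠ 0 ∧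
      H.natDegree ≤ (l + d * m) * f.natDegree + M + Fintype.card K * (L + E) ∧
      ∀ x, (f.eval x) ^ m = ζ → (X - C x) ^ l ∣ H := by
  set q := Fintype.card K
  set W := (X - C a) ^ q with hW
  have hd : 0 < d := by
    rcases Nat.eq_zero_or_pos d with h | h
    · subst h; simp at hdim
    · exact h
  have hM : 0 < M := by
    rcases Nat.eq_zero_or_pos M with h | h
    · subst h; simp at hdim
    · exact h
  choose Q hQ hQdeg using fun (k : Fin l) (j : Fin d) =>
    exists_linearMap_hasseDeriv_pow_mul hf (N := l + j * m) (k := k) (by omega)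
  let T := M + l * f.natDegree + (L + E)
  let R : Fin l → (Fin d × Fin (L + E) → degreeLT K M) →ₗ[K] K[X] := fun k =>
    ∑ ji : Fin d × Fin (L + E), (LinearMap.mulLeft K (C (ζ ^ (ji.1 : ℕ)) * (X - C a) ^ (ji.2 : ℕ))).comp
      ((Q k ji.1).comp ((degreeLT K M).subtype.comp (LinearMap.proj ji)))
  have hRapp : ∀ k A, R k A = ∑ ji : Fin d × Fin (L + E),
      (C (ζ ^ (ji.1 : ℕ)) * (X - C a) ^ (ji.2 : ℕ)) * Q k ji.1 (A ji : K[X]) := by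
    intro k A
    simp only [R, LinearMap.sum_apply, LinearMap.comp_apply, LinearMap.mulLeft_apply,
      Submodule.subtype_apply, LinearMap.proj_apply]
  let Φ : (Fin d × Fin (L + E) → degreeLT K M) →ₗ[K] (Fin l × Fin T → K) :=
    LinearMap.pi fun kn => (lcoeff K (kn.2 : ℕ)).comp (R kn.1)
  have hfin : Module.finrank K (degreeLT K M) = M := by
    rw [(degreeLTEquiv K M).finrank_eq, Module.finrank_fin_fun]
  have hker : LinearMap.ker Φ ≠ ⊥ := by
    have : Module.Finite K (degreeLT K M) := Module.Finite.equiv (degreeLTEquiv K M).symm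
    apply LinearMap.ker_ne_bot_of_finrank_lt
    rw [Module.finrank_fintype_fun_eq_card, Module.finrank_pi_fintype]
    simpa [hfin, T] using hdim
  obtain ⟨A, hA, hA0⟩ := Submodule.exists_mem_ne_zero_of_ne_bot hker
  have hAdeg : ∀ ji, (A ji : K[X]).natDegree ≤ M - 1 := fun ji => by
    have h1 := mem_degreeLT.1 (A ji).2
    by_cases h0 : (A ji : K[X]) = 0
    · simp [h0]
    · exact Nat.le_sub_one_of_lt ((natDegree_lt_iff_degree_lt h0).2 h1)
  have hR0 : ∀ k, R k A = 0 := by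
    intro k
    have hdeg : (R k A).natDegree < T := by
      rw [hRapp]
      refine lt_of_le_of_lt (natDegree_sum_le_of_forall_le (n := T - 1) _ _ fun ji _ => ?_)
        (by omega)
      refine natDegree_mul_le.trans ?_
      have h1 := hQdeg k ji.1 (A ji)
      have h2 := natDegree_C_mul_le (ζ ^ (ji.1 : ℕ)) ((X - C a) ^ (ji.2 : ℕ))
      rw [natDegree_pow, natDegree_X_sub_C] at h2
      have h3 := hAdeg ji
      have h4 : (k : ℕ) * f.natDegree ≤ l * f.natDegree := Nat.mul_le_mul_right _ k.2.le
      have h5 := ji.2.2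
      omega
    ext n
    rw [coeff_zero]
    rcases lt_or_ge n T with hn | hn
    · exact congrFun (LinearMap.mem_ker.1 hA) (k, ⟨n, hn⟩)
    · exact coeff_eq_zero_of_natDegree_lt (by omega)
  refine ⟨∑ ji : Fin d × Fin (L + E), f ^ (l + ji.1 * m) * (A ji : K[X]) * W ^ (ji.2 : ℕ),
    ?_, ?_, ?_⟩
  · intro hH
    let P : Fin (L + E) → K[X][X] := fun i => ∑ j : Fin d, monomial j (A (j, i) : K[X])
    have hPc : ∀ i (j : Fin d), (P i).coeff j = A (j, i) := by
      intro i j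
      simp only [P, finsetSum_coeff, coeff_monomial]
      simp [Fin.val_inj]
    have hPz : ∀ i, W ∣ (P i).eval (f ^ m) → P i = 0 := by
      intro i
      have hPn : (P i).natDegree < d := by
        refine lt_of_le_of_lt (natDegree_sum_le_of_forall_le (n := d - 1) _ _ fun j _ => ?_)
          (by omega)
        exact (natDegree_monomial_le _).trans (by omega)
      refine hnon (P i) hPn fun j => ?_
      rcases lt_or_ge j d with hj | hj
      · rw [hPc i ⟨j, hj⟩]
        exact (hAdeg _).trans (by omega)
      · rw [coeff_eq_zero_of_natDegree_lt (by omega)]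
        simp
    have hsum : ∑ i : Fin (L + E), W ^ (i : ℕ) * (P i).eval (f ^ m) = 0 := by
      have h1 : f ^ l * ∑ i : Fin (L + E), W ^ (i : ℕ) * (P i).eval (f ^ m) = 0 := by
        rw [← hH, Fintype.sum_prod_type_right, Finset.mul_sum]
        refine Finset.sum_congr rfl fun i _ => ?_
        simp only [P, eval_finsetSum, eval_monomial, Finset.mul_sum]
        refine Finset.sum_congr rfl fun j _ => ?_
        rw [pow_add, mul_comm (j : ℕ) m, pow_mul]
        ring
      exact (mul_eq_zero.1 h1).resolve_left (pow_ne_zero _ hf)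
    have hz := eq_zero_of_sum_pow_mul_eq_zero (pow_ne_zero _ (X_sub_C_ne_zero a))
      (fun i hi => by rw [hPz i hi, eval_zero]) hsum
    refine hA0 (funext fun ji => Subtype.ext ?_)
    have h2 := hPz ji.2 (by rw [hz ji.2]; exact dvd_zero _)
    have h3 := hPc ji.2 ji.1
    rw [h2, coeff_zero] at h3
    exact h3.symm
  · refine natDegree_sum_le_of_forall_le _ _ fun ji _ => ?_
    refine natDegree_mul_le.trans ?_
    have h1 := natDegree_mul_le (p := f ^ (l + ji.1 * m)) (q := (A ji : K[X]))
    rw [natDegree_pow] at h1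
    have h2 : (W ^ (ji.2 : ℕ)).natDegree = ji.2 * q := by
      rw [hW, natDegree_pow, natDegree_pow, natDegree_X_sub_C, mul_one]
    have h3 : (ji.2 : ℕ) * q ≤ q * (L + E) := by
      rw [mul_comm]; exact Nat.mul_le_mul_left _ ji.2.2.le
    have h4 : (l + ji.1 * m) * f.natDegree ≤ (l + d * m) * f.natDegree := by
      have := ji.1.2.le
      gcongr
    have h5 := hAdeg ji
    omega
  · intro x hx
    have hsub : (X - C x) ^ l ∣ (∑ ji : Fin d × Fin (L + E), f ^ (l + ji.1 * m) * (A ji : K[X]) * W ^ (ji.2 : ℕ)) -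
        ∑ ji : Fin d × Fin (L + E), f ^ (l + ji.1 * m) * (A ji : K[X]) * C (x - a) ^ (ji.2 : ℕ) := by
      rw [← Finset.sum_sub_distrib]
      refine Finset.dvd_sum fun ji _ => ?_
      rw [← mul_sub]
      refine Dvd.dvd.mul_left (dvd_trans ?_ (sub_dvd_pow_sub_pow _ _ _)) _
      have := X_sub_C_pow_card_dvd x (X - C a)
      rw [eval_sub, eval_X, eval_C] at this
      exact (pow_dvd_pow _ hl).trans this
    refine (dvd_iff_dvd_of_dvd_sub hsub).2 (X_sub_C_pow_dvd_of_hasseDeriv fun k hk => ?_)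
    have h1 := congrArg (eval x) (hR0 ⟨k, hk⟩)
    rw [hRapp, eval_finsetSum, eval_zero] at h1
    rw [map_sum, eval_finsetSum]
    rw [← mul_zero ((f.eval x) ^ (l - k)), ← h1, Finset.mul_sum]
    refine Finset.sum_congr rfl fun ji _ => ?_
    have h2 : f ^ (l + (ji.1 : ℕ) * m) * (A ji : K[X]) * C (x - a) ^ (ji.2 : ℕ) =
      (x - a) ^ (ji.2 : ℕ) • (f ^ (l + (ji.1 : ℕ) * m) * (A ji : K[X])) := by
      rw [smul_eq_C_mul, C_pow, mul_comm]
    rw [h2, map_smul, hQ ⟨k, hk⟩ ji.1, eval_smul, eval_mul, eval_mul, eval_mul, eval_pow, eval_pow,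
      eval_C, eval_sub, eval_X, eval_C]
    simp only
    rw [show l + (ji.1 : ℕ) * m - k = (l - k) + m * ji.1 by rw [mul_comm m]; omega, pow_add,
      pow_mul, hx, smul_eq_mul]
    ring

theorem FiniteField.card_mul_le_of_stepanov {K : Type*} [Field K] [Fintype K] [DecidableEq K]
    {f : K[X]} (hf : f ≠ 0) {d s L : ℕ} (hd : 0 < d) (hq : Fintype.card K = s ^ 2)
    (hs : s = d * L + 1) (hlarge : 2 * s + 2 * d * f.natDegree + 2 < s ^ 2)
    (hgcd : ∀ k, (∀ x, d ∣ k * f.rootMultiplicity x) → d ∣ k)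
    {a : K} (ha : f.eval a ≠ 0) (ζ : K) :
    #{x : K | (f.eval x) ^ (L * (s + 1)) = ζ} * (d * L) ≤ s ^ 2 * (L + 4 * f.natDegree + 3) := by
  set m := L * (s + 1) with hm
  set D := f.natDegree
  have hdm : d * m + 1 = s ^ 2 := by rw [hm, hs]; ring
  have hDm : D < m := by
    by_contra h
    have := Nat.mul_le_mul_left d (not_lt.1 h)
    have : 2 * d * D = 2 * (d * D) := by ring
    omega
  obtain ⟨M, hM⟩ := Nat.exists_eq_add_of_le hDm.le
  have hdM : d * M + d * D + 1 = s ^ 2 := by rw [← hdm, hM]; ring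
  obtain ⟨H, hH0, hHd, hH⟩ := exists_auxiliary_polynomial hf (d := d) (L := L) (E := 2 * D + 2)
    (M := M) (m := m) (l := d * L) a ζ (by rw [hq]; nlinarith) (by
      have h1 : d * L < s := by omega
      have h2 : d * (L + (2 * D + 2)) * M = d * L * M + (2 * D + 2) * (d * M) := by ring
      have h3 : d * L * (M + d * L * D + (L + (2 * D + 2))) =
        d * L * M + ((d * L) * (d * L) * D + (d * L) * L + (d * L) * (2 * D + 2)) := by ring
      rw [h2, h3]
      have h4 : (d * L) * (d * L) ≤ s ^ 2 := by nlinarith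
      have h5 : (d * L) * L ≤ s ^ 2 := by nlinarith
      have h6 : (d * L) * (d * L) * D ≤ s ^ 2 * D := Nat.mul_le_mul_right _ h4
      have h7 : (d * L) * (2 * D + 2) ≤ s * (2 * D + 2) := Nat.mul_le_mul_right _ h1.le
      have h8 : s ^ 2 + 1 ≤ 2 * (d * M) - 2 * s := by
        have : 2 * d * D = 2 * (d * D) := by ring
        omega
      have h9 : s ^ 2 + 2 * s + 1 ≤ 2 * (d * M) := by
        have : 2 * d * D = 2 * (d * D) := by ring
        omega
      have h10 := Nat.mul_le_mul_left (D + 1) h9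
      nlinarith) (by
      intro P hPd hPM hW
      refine eq_zero_of_dvd_eval_of_C_mul_pow_sub hd hf hgcd ha hPd hPM ?_ ?_ hW
      · rw [natDegree_pow, natDegree_X_sub_C, hq]
        change d * M + d * D < _
        omega
      · have := X_sub_C_pow_card_dvd a f
        rwa [← pow_mul, ← pow_succ', mul_comm m, hdm, ← hq])
  set S := ({x : K | (f.eval x) ^ m = ζ} : Finset K)
  have hprod : ∏ x ∈ S, (X - C x) ^ (d * L) ∣ H := by
    refine Finset.prod_dvd_of_coprime (fun x _ y _ hxy => ?_)
      (fun x hx => hH x (by simpa [S] using hx))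
    exact (isCoprime_X_sub_C_of_isUnit_sub (sub_ne_zero.2 hxy).isUnit).pow
  have h1 := natDegree_le_of_dvd hprod hH0
  rw [natDegree_prod _ _ (fun x _ => pow_ne_zero _ (X_sub_C_ne_zero x))] at h1
  simp only [natDegree_pow, natDegree_X_sub_C, mul_one, Finset.sum_const, smul_eq_mul] at h1
  refine h1.trans (hHd.trans ?_)
  rw [hq]
  have h2 : (d * L + d * m) * D ≤ (s ^ 2 + s ^ 2) * D := by
    apply Nat.mul_le_mul_right
    nlinarith
  have h3 : M ≤ s ^ 2 := by nlinarith
  nlinarith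

theorem IsPrimitiveRoot.norm_sum_le_of_card_fiber_le {K : Type*} [Fintype K] {h : K → ℂ} {d : ℕ}
    {ω : ℂ} (hω : IsPrimitiveRoot ω d) (hd : 1 < d) (hh : ∀ x, h x = 0 ∨ h x ^ d = 1) {B : ℝ}
    (hB : ∀ w : ℂ, w ^ d = 1 → (#{x | h x = w} : ℝ) ≤ B) :
    ‖∑ x, h x‖ ≤ d * B - #{x | h x ≠ 0} := by
  have hd0 : NeZero d := ⟨by omega⟩
  have hmaps : ∀ x ∈ ({x | h x ≠ 0} : Finset K), h x ∈ Polynomial.nthRootsFinset d (1 : ℂ) := by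
    intro x hx
    rw [Polynomial.mem_nthRootsFinset (by omega)]
    exact (hh x).resolve_left (by simpa using hx)
  have hfib : ∀ w ∈ Polynomial.nthRootsFinset d (1 : ℂ),
      Finset.filter (fun x => h x = w) (Finset.filter (fun x => h x ≠ 0) Finset.univ) =
        Finset.filter (fun x => h x = w) Finset.univ := by
    intro w hw
    rw [Polynomial.mem_nthRootsFinset (by omega)] at hw
    ext x
    simp only [Finset.mem_filter, Finset.mem_univ, true_and, and_iff_right_iff_imp]
    rintro rfl h0
    rw [h0, zero_pow (by omega)] at hw
    exact zero_ne_one hw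
  have hcard : #(Polynomial.nthRootsFinset d (1 : ℂ)) = d := hω.card_nthRootsFinset
  have hzero : ∑ w ∈ Polynomial.nthRootsFinset d (1 : ℂ), w = 0 := by
    rw [← hω.geom_sum_eq_zero hd]
    symm
    refine Finset.sum_bij (fun i _ => ω ^ i) (fun i _ => ?_) (fun i hi j hj hij => ?_)
      (fun w hw => ?_) (fun _ _ => rfl)
    · rw [Polynomial.mem_nthRootsFinset (by omega), ← pow_mul, mul_comm, pow_mul, hω.pow_eq_one,
        one_pow]
    · exact hω.pow_inj (Finset.mem_range.1 hi) (Finset.mem_range.1 hj) hij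
    · rw [Polynomial.mem_nthRootsFinset (by omega)] at hw
      obtain ⟨i, hi, rfl⟩ := hω.eq_pow_of_pow_eq_one hw
      exact ⟨i, Finset.mem_range.2 hi, rfl⟩
  have hsum : ∑ x, h x =
      ∑ w ∈ Polynomial.nthRootsFinset d (1 : ℂ), ((#{x | h x = w} : ℝ) - B : ℝ) * w := by
    have h1 : ∑ x, h x = ∑ x ∈ ({x | h x ≠ 0} : Finset K), h x :=
      (Finset.sum_filter_ne_zero _).symm
    rw [h1, ← Finset.sum_fiberwise_of_maps_to hmaps]
    have h2 : ∑ w ∈ Polynomial.nthRootsFinset d (1 : ℂ), ((B : ℝ) : ℂ) * w = 0 := by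
      rw [← Finset.mul_sum, hzero, mul_zero]
    simp only [Complex.ofReal_sub, sub_mul, Finset.sum_sub_distrib, h2, sub_zero]
    refine Finset.sum_congr rfl fun w hw => ?_
    rw [hfib w hw, Finset.sum_congr rfl (g := fun _ => w) (fun x hx => by simpa using hx),
      Finset.sum_const, nsmul_eq_mul]
    push_cast
    rfl
  rw [hsum]
  refine (norm_sum_le _ _).trans ?_
  have h3 : ∀ w ∈ Polynomial.nthRootsFinset d (1 : ℂ),
      ‖(((#{x | h x = w} : ℝ) - B : ℝ) : ℂ) * w‖ ≤ B - (#{x | h x = w} : ℝ) := by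
    intro w hw
    rw [Polynomial.mem_nthRootsFinset (by omega)] at hw
    rw [norm_mul, Complex.norm_eq_one_of_pow_eq_one hw (by omega), mul_one, Complex.norm_real,
      Real.norm_eq_abs, abs_of_nonpos (by linarith [hB w hw]), neg_sub]
  refine (Finset.sum_le_sum h3).trans (le_of_eq ?_)
  rw [Finset.sum_sub_distrib, Finset.sum_const, hcard, nsmul_eq_mul,
    Finset.card_eq_sum_card_fiberwise hmaps]
  push_cast
  congr 1
  exact Finset.sum_congr rfl fun w hw => by rw [hfib w hw]

theorem MulChar.pow_eq_pow_of_apply_eq {K : Type*} [Field K] [Finite K] {X : MulChar K ℂ} {m : ℕ}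
    (hm : orderOf X * m = Nat.card K - 1) {y z : K} (hy : y ≠ 0) (hz : z ≠ 0) (h : X y = X z) :
    y ^ m = z ^ m := by
  obtain ⟨g, hg⟩ := IsCyclic.exists_generator (α := Kˣ)
  obtain ⟨i, hi⟩ := hg (Units.mk0 y hy / Units.mk0 z hz)
  have h1 : X (Units.mk0 y hy / Units.mk0 z hz : Kˣ) = 1 := by
    have h2 : X y = X (Units.mk0 y hy / Units.mk0 z hz : Kˣ) * X z := by
      rw [← map_mul]
      simp [div_mul_cancel₀ _ hz]
    have h3 : X z ≠ 0 := by
      have := (hz.isUnit.map X).ne_zero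
      exact this
    rw [h] at h2
    exact (mul_eq_right₀ h3).1 h2.symm
  simp only at hi
  have h4 : (X.toUnitHom g) ^ i = 1 := by
    rw [← map_zpow, hi]
    ext
    rw [MulChar.coe_toUnitHom, h1, Units.val_one]
  have h5 : orderOf X ∣ orderOf (X.toUnitHom g) := by
    rw [orderOf_dvd_iff_pow_eq_one, MulChar.eq_iff hg, MulChar.pow_apply_coe, MulChar.one_apply_coe,
      ← MulChar.coe_toUnitHom, ← Units.val_pow_eq_pow_val, pow_orderOf_eq_one, Units.val_one]
  have h6 : (orderOf X : ℤ) ∣ i :=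
    (Int.natCast_dvd_natCast.2 h5).trans (orderOf_dvd_iff_zpow_eq_one.2 h4)
  obtain ⟨j, rfl⟩ := h6
  have h7 : (Units.mk0 y hy / Units.mk0 z hz) ^ m = 1 := by
    rw [← hi, ← zpow_natCast, ← zpow_mul, mul_assoc, mul_comm j, ← mul_assoc, ← Nat.cast_mul, hm,
      zpow_mul, zpow_natCast, ← Nat.card_units, pow_card_eq_one', one_zpow]
  rw [div_pow, div_eq_one] at h7
  simpa using congrArg Units.val h7

theorem MulChar.norm_sum_eval_le_of_large {K : Type*} [Field K] [Fintype K] {X : MulChar K ℂ}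
    (hX : X ≠ 1) {s : ℕ} (hq : Fintype.card K = s ^ 2) (hs : orderOf X ∣ s - 1) {f : K[X]}
    (hf : f ≠ 0) (hlarge : 2 * s + 2 * orderOf X * f.natDegree + 2 < s ^ 2)
    (hgcd : ∀ k, (∀ x, orderOf X ∣ k * f.rootMultiplicity x) → orderOf X ∣ k) :
    ‖∑ x, X (f.eval x)‖ ≤ (2 * orderOf X * (4 * f.natDegree + 3) + f.natDegree) * s := by
  classical
  set d := orderOf X with hdX
  have hd0 : 0 < d := orderOf_pos X
  have hd : 1 < d := by
    have : d ≠ 1 := fun h => hX (orderOf_eq_one_iff.1 h)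
    omega
  obtain ⟨L, hL⟩ := hs
  have hs2 : 2 < s := by nlinarith
  have hsL : s = d * L + 1 := by omega
  set D := f.natDegree
  have hroots : #{x | f.eval x = 0} ≤ D := by
    refine le_trans (Finset.card_le_card ?_) ((Multiset.toFinset_card_le _).trans f.card_roots')
    intro x hx
    rw [Multiset.mem_toFinset, mem_roots hf]
    simpa using hx
  have hDs : D < s ^ 2 := by nlinarith
  obtain ⟨a, ha⟩ : ∃ a, f.eval a ≠ 0 := by
    by_contra! h
    rw [Finset.filter_true_of_mem (fun x _ => h x), Finset.card_univ, hq] at hroots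
    omega
  have hfib : ∀ w : ℂ, w ^ d = 1 →
      (#{x | X (f.eval x) = w} : ℝ) ≤ s ^ 2 / d + 2 * s * (4 * D + 3) := by
    intro w hw
    have hw0 : w ≠ 0 := by
      rintro rfl
      rw [zero_pow hd0.ne'] at hw
      exact zero_ne_one hw
    rcases Finset.eq_empty_or_nonempty ({x | X (f.eval x) = w} : Finset K) with he | ⟨x₀, hx₀⟩
    · rw [he]
      simp only [Finset.card_empty, Nat.cast_zero]
      positivity
    · have hx₀' : X (f.eval x₀) = w := by simpa using hx₀
      have hne : ∀ x, X (f.eval x) = w → f.eval x ≠ 0 := fun x hx h0 => by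
        rw [h0, MulChar.map_zero] at hx
        exact hw0 hx.symm
      have h1 := FiniteField.card_mul_le_of_stepanov hf hd0 hq hsL hlarge hgcd ha
        ((f.eval x₀) ^ (L * (s + 1)))
      have h2 : #{x | X (f.eval x) = w} ≤
          #{x : K | (f.eval x) ^ (L * (s + 1)) = (f.eval x₀) ^ (L * (s + 1))} := by
        refine Finset.card_le_card fun x hx => ?_
        have hx' : X (f.eval x) = w := by simpa using hx
        simp only [Finset.mem_filter, Finset.mem_univ, true_and]
        refine MulChar.pow_eq_pow_of_apply_eq (X := X) ?_ (hne x hx') (hne x₀ hx₀')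
          (hx'.trans hx₀'.symm)
        rw [Nat.card_eq_fintype_card, hq, hsL, ← hdX]
        refine (Nat.sub_eq_of_eq_add ?_).symm
        ring
      have h3 := (Nat.mul_le_mul_right (d * L) h2).trans h1
      have h4 : (#{x | X (f.eval x) = w} : ℝ) * (d * L) ≤ s ^ 2 * (L + 4 * D + 3) := by
        exact_mod_cast h3
      have hsr : (s : ℝ) = d * L + 1 := by exact_mod_cast hsL
      have hs2r : (2 : ℝ) < s := by exact_mod_cast hs2
      have hdr : (0 : ℝ) < d := by exact_mod_cast hd0
      have hdL : (0 : ℝ) < d * L := by linarith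
      refine le_of_mul_le_mul_right (h4.trans ?_) hdL
      have h5 : ((s : ℝ) ^ 2 / d + 2 * s * (4 * D + 3)) * (d * L) =
        s ^ 2 * L + 2 * (d * L) * s * (4 * D + 3) := by
        field_simp
      rw [h5]
      have h6 : (s : ℝ) ≤ 2 * (d * L) := by linarith
      have h7 : (s : ℝ) * (s * (4 * D + 3)) ≤ 2 * (d * L) * (s * (4 * D + 3)) := by gcongr
      linarith
  obtain ⟨ω, hω⟩ : ∃ ω : ℂ, IsPrimitiveRoot ω d := ⟨_, Complex.isPrimitiveRoot_exp d hd0.ne'⟩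
  have hmain := hω.norm_sum_le_of_card_fiber_le hd (h := fun x => X (f.eval x)) (fun x => by
    by_cases h0 : f.eval x = 0
    · left; simp [h0]
    · right
      rw [← MulChar.pow_apply' _ hd0.ne', hdX, pow_orderOf_eq_one, MulChar.one_apply (Ne.isUnit h0)])
    hfib
  refine hmain.trans ?_
  have hne : (s : ℝ) ^ 2 - D ≤ #{x | X (f.eval x) ≠ 0} := by
    have h1 : #{x | f.eval x = 0} + #{x | ¬ f.eval x = 0} = s ^ 2 := by
      rw [Finset.card_filter_add_card_filter_not, Finset.card_univ, hq]
    have h2 : #{x | ¬ f.eval x = 0} ≤ #{x | X (f.eval x) ≠ 0} := by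
      refine Finset.card_le_card fun x hx => ?_
      simp only [Finset.mem_filter, Finset.mem_univ, true_and] at hx ⊢
      exact ((Ne.isUnit hx).map X).ne_zero
    have h3 : s ^ 2 ≤ #{x | X (f.eval x) ≠ 0} + D := by omega
    have h4 : (s : ℝ) ^ 2 ≤ #{x | X (f.eval x) ≠ 0} + D := by exact_mod_cast h3
    linarith
  have hdr : (0 : ℝ) < d := by exact_mod_cast hd0
  have h5 : (d : ℝ) * (s ^ 2 / d + 2 * s * (4 * D + 3)) = s ^ 2 + 2 * d * (4 * D + 3) * s := by
    field_simp
  have h6 : (D : ℝ) ≤ D * s := le_mul_of_one_le_right (by positivity) (by exact_mod_cast (by omega))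
  rw [h5]
  linarith

/-- The multiplicative character of a finite extension `K` of `F` obtained by composing a
multiplicative character of `F` with the norm. -/
noncomputable def MulChar.compNorm {F : Type*} [Field F] (K : Type*) [Field K] [Algebra F K]
    (χ : MulChar F ℂ) : MulChar K ℂ :=
  MulChar.ofUnitHom (χ.toUnitHom.comp (Units.map (Algebra.norm F)))

theorem MulChar.compNorm_apply {F K : Type*} [Field F] [Field K] [Algebra F K]
    [FiniteDimensional F K] (χ : MulChar F ℂ) (y : K) : χ.compNorm K y = χ (Algebra.norm F y) := by
  by_cases hy : y = 0
  · simp [hy, Algebra.norm_zero]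
  · have h := MulChar.ofUnitHom_coe (χ.toUnitHom.comp (Units.map (Algebra.norm F))) (Units.mk0 y hy)
    simpa [MulChar.compNorm, MulChar.coe_toUnitHom] using h

theorem MulChar.orderOf_compNorm {F K : Type*} [Field F] [Field K] [Algebra F K] [Finite K]
    [FiniteDimensional F K] (χ : MulChar F ℂ) : orderOf (χ.compNorm K) = orderOf χ := by
  rw [orderOf_eq_orderOf_iff]
  intro n
  constructor
  · intro h
    ext a
    obtain ⟨y, hy⟩ := FiniteField.unitsMap_norm_surjective F K a
    have h1 := congrArg (fun ψ : MulChar K ℂ => ψ (y : K)) h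
    simp only [MulChar.pow_apply_coe, MulChar.compNorm_apply, MulChar.one_apply_coe] at h1
    rw [MulChar.pow_apply_coe, MulChar.one_apply_coe, ← hy]
    exact h1
  · intro h
    ext a
    have h1 := congrArg (fun ψ : MulChar F ℂ => ψ (Units.map (Algebra.norm F) a : Fˣ)) h
    simp only [MulChar.pow_apply_coe, MulChar.one_apply_coe] at h1
    rw [MulChar.pow_apply_coe, MulChar.one_apply_coe, MulChar.compNorm_apply]
    exact h1

theorem Polynomial.rootMultiplicity_prod_C_sub_X_pow {K ι : Type*} [Field K] 
    (V : Finset ι) (e : ι → ℕ) {a : ι → K} (ha : Function.Injective a) {v : ι} (hv : v ∈ V) :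
    (∏ w ∈ V, (C (a w) - X) ^ e w).rootMultiplicity (a v) = e v := by
  classical
  have h0 : ∀ w, (C (a w) - X : K[X]) ≠ 0 := fun w => by
    rw [← neg_sub, neg_ne_zero]
    exact X_sub_C_ne_zero _
  rw [← count_roots, roots_prod _ _ (Finset.prod_ne_zero_iff.2 fun w _ => pow_ne_zero _ (h0 w)),
    Multiset.count_bind]
  have h1 : ∀ w, Multiset.count (a v) ((C (a w) - X : K[X]) ^ e w).roots =
      if w = v then e v else 0 := by
    intro w
    rw [roots_pow, Multiset.count_nsmul, ← neg_sub, roots_neg, roots_X_sub_C,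
      Multiset.count_singleton]
    by_cases h : w = v
    · simp [h]
    · rw [if_neg (fun h' => h (ha h').symm), if_neg h, mul_zero]
  simp only [h1]
  change ∑ w ∈ V, (if w = v then e v else 0) = e v
  rw [Finset.sum_ite_eq' V v, if_pos hv]

theorem MulChar.norm_sum_compNorm_le_of_large {F K : Type*} [Field F] [Field K] [Algebra F K]
    [Fintype K] [FiniteDimensional F K] (χ : MulChar F ℂ) {V : Finset F} {e : F → ℕ}
    (hV : ∃ v ∈ V, χ ^ e v ≠ 1) {s : ℕ} (hq : Fintype.card K = s ^ 2) (hs : orderOf χ ∣ s - 1)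
    (hlarge : 2 * s + 2 * orderOf χ * (∑ v ∈ V, e v) + 2 < s ^ 2)  :
    ‖∑ x : K, ∏ v ∈ V, (χ (Algebra.norm F (algebraMap F K v - x))) ^ e v‖ ≤
      (2 * orderOf χ * (4 * (∑ v ∈ V, e v : ℕ) + 3) + (∑ v ∈ V, e v : ℕ)) * s := by
  classical
  have : Finite F := Finite.of_injective _ (algebraMap F K).injective
  set d := orderOf χ with hd
  have hd0 : 0 < d := orderOf_pos χ
  set g := Nat.gcd d (V.gcd e) with hg
  have hg0 : 0 < g := Nat.gcd_pos_of_pos_left _ hd0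
  obtain ⟨d', hd'⟩ : g ∣ d := Nat.gcd_dvd_left _ _
  have hge : ∀ v ∈ V, g ∣ e v := fun v hv => (Nat.gcd_dvd_right _ _).trans (Finset.gcd_dvd hv)
  have he : ∀ v ∈ V, e v = g * (e v / g) := fun v hv => (Nat.mul_div_cancel' (hge v hv)).symm
  set X' := (χ ^ g).compNorm K with hX'
  have hoX : orderOf X' = d' := by
    rw [hX', MulChar.orderOf_compNorm, orderOf_pow_of_dvd hg0.ne' ⟨d', hd'⟩, ← hd, hd',
      Nat.mul_div_cancel_left _ hg0]
  set f : K[X] := ∏ v ∈ V, (C (algebraMap F K v) - X) ^ (e v / g) with hf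
  have h0 : ∀ w, (C (algebraMap F K w) - X : K[X]) ≠ 0 := fun w => by
    rw [← neg_sub, neg_ne_zero]
    exact X_sub_C_ne_zero _
  have hf0 : f ≠ 0 := Finset.prod_ne_zero_iff.2 fun w _ => pow_ne_zero _ (h0 w)
  have hdeg : f.natDegree ≤ ∑ v ∈ V, e v := by
    refine (natDegree_prod_le _ _).trans (Finset.sum_le_sum fun v _ => ?_)
    refine natDegree_pow_le.trans ?_
    have h1 : (C (algebraMap F K v) - X : K[X]).natDegree = 1 := by
      rw [← neg_sub, natDegree_neg, natDegree_X_sub_C]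
    rw [h1, mul_one]
    exact Nat.div_le_self _ _
  have hd'd : d' ≤ d := Nat.le_of_dvd hd0 ⟨g, by rw [hd', mul_comm]⟩
  have hX1 : X' ≠ 1 := by
    intro h
    rw [← orderOf_eq_one_iff, hoX] at h
    obtain ⟨v, hv, hv1⟩ := hV
    apply hv1
    rw [← orderOf_dvd_iff_pow_eq_one, ← hd, hd', h, mul_one]
    exact hge v hv
  have key := MulChar.norm_sum_eval_le_of_large hX1 hq
    (hoX ▸ (Dvd.intro_left g hd'.symm).trans hs) hf0 (by
      rw [hoX]
      refine lt_of_le_of_lt ?_ hlarge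
      gcongr) (by
      rw [hoX]
      intro k hk
      have h1 : ∀ v ∈ V, d ∣ k * e v := by
        intro v hv
        have h2 := hk (algebraMap F K v)
        rw [Polynomial.rootMultiplicity_prod_C_sub_X_pow V _ (algebraMap F K).injective hv] at h2
        rw [he v hv, hd', mul_left_comm]
        exact mul_dvd_mul_left g h2
      have h3 : d ∣ k * g := by
        rw [hg, ← Nat.gcd_mul_left]
        refine Nat.dvd_gcd (Dvd.intro_left k rfl) ?_
        have h4 : d ∣ V.gcd (fun v => k * e v) := Finset.dvd_gcd h1
        rwa [Finset.gcd_mul_left, normalize_eq] at h4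
      rw [hd', mul_comm k] at h3
      exact Nat.dvd_of_mul_dvd_mul_left hg0 h3)
  have hsum : ∀ x, X' (f.eval x) =
      ∏ v ∈ V, (χ (Algebra.norm F (algebraMap F K v - x))) ^ e v := by
    intro x
    rw [hf, eval_prod, map_prod]
    refine Finset.prod_congr rfl fun v hv => ?_
    rw [eval_pow, map_pow, eval_sub, eval_C, eval_X, hX', MulChar.compNorm_apply,
      MulChar.pow_apply' _ hg0.ne', ← pow_mul, ← he v hv]
  simp only [hsum, hoX] at key
  refine key.trans ?_
  have h5 : (d' : ℝ) ≤ d := by exact_mod_cast hd'd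
  have h6 : (f.natDegree : ℝ) ≤ (∑ v ∈ V, e v : ℕ) := by exact_mod_cast hdeg
  gcongr

theorem Complex.norm_le_of_norm_powerSum_le {ι : Type*} [Fintype ι] (α : ι → ℂ) {B R : ℝ}
    (hR : 0 < R) {n₀ : ℕ} (h : ∀ n ≥ n₀, ‖∑ i, α i ^ n‖ ≤ B * R ^ n) (i : ι) : ‖α i‖ ≤ R := by
  classical
  by_contra! hlt
  set β := α i with hβ
  set Q : ℂ[X] := ∏ a ∈ (Finset.univ.image α).erase β, (X - C a) with hQ
  have hQβ : Q.eval β ≠ 0 := by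
    rw [hQ, eval_prod, Finset.prod_ne_zero_iff]
    intro a ha
    rw [eval_sub, eval_X, eval_C, sub_ne_zero]
    exact (Finset.ne_of_mem_erase ha).symm
  have hQα : ∀ j, Q.eval (α j) = if α j = β then Q.eval β else 0 := by
    intro j
    by_cases hj : α j = β
    · rw [if_pos hj, hj]
    · rw [if_neg hj, hQ, eval_prod]
      refine Finset.prod_eq_zero (i := α j)
        (Finset.mem_erase.2 ⟨hj, Finset.mem_image_of_mem _ (Finset.mem_univ _)⟩) ?_
      simp
  have hcomb : ∀ n, ∑ k ∈ Q.support, Q.coeff k * ∑ j, α j ^ (n + k) =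
      #{j | α j = β} * Q.eval β * β ^ n := by
    intro n
    have h1 : ∀ j, ∑ k ∈ Q.support, Q.coeff k * α j ^ (n + k) = Q.eval (α j) * α j ^ n := by
      intro j
      rw [eval_eq_sum, Polynomial.sum, Finset.sum_mul]
      exact Finset.sum_congr rfl fun k _ => by ring
    simp only [Finset.mul_sum]
    rw [Finset.sum_comm]
    simp only [h1, hQα, ite_mul, zero_mul]
    rw [← Finset.sum_filter, Finset.sum_congr rfl (g := fun _ => Q.eval β * β ^ n) (fun j hj => by
      rw [(Finset.mem_filter.1 hj).2]), Finset.sum_const, nsmul_eq_mul, mul_assoc]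
  have hcard : (1 : ℝ) ≤ #{j | α j = β} := by
    exact_mod_cast Finset.card_pos.2 ⟨i, by simp [hβ]⟩
  set M := ∑ k ∈ Q.support, ‖Q.coeff k‖ * (B * R ^ k)
  have hbound : ∀ n ≥ n₀, ‖Q.eval β‖ * ‖β‖ ^ n ≤ M * R ^ n := by
    intro n hn
    have h1 : ‖Q.eval β‖ * ‖β‖ ^ n ≤ ‖(#{j | α j = β} : ℂ) * Q.eval β * β ^ n‖ := by
      rw [norm_mul, norm_mul, norm_pow, Complex.norm_natCast, mul_assoc]
      exact le_mul_of_one_le_left (by positivity) hcard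
    rw [← hcomb] at h1
    refine h1.trans ((norm_sum_le _ _).trans ?_)
    rw [Finset.sum_mul]
    refine Finset.sum_le_sum fun k _ => ?_
    rw [norm_mul, mul_assoc]
    refine mul_le_mul_of_nonneg_left ((h (n + k) (by omega)).trans (le_of_eq ?_)) (norm_nonneg _)
    ring
  have hratio : 1 < ‖β‖ / R := (one_lt_div hR).2 hlt
  have hQ0 : 0 < ‖Q.eval β‖ := norm_pos_iff.2 hQβ
  obtain ⟨n, hn⟩ := pow_unbounded_of_one_lt (M / ‖Q.eval β‖) hratio
  have h2 := hbound (max n n₀) (le_max_right _ _)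
  have h3 := hn.trans_le (pow_le_pow_right₀ hratio.le (le_max_left n n₀))
  rw [div_pow, div_lt_div_iff₀ hQ0 (by positivity)] at h3
  linarith

theorem MvPolynomial.neg_one_pow_mul_esymm_eq_sum {σ : Type*} [Fintype σ] [DecidableEq σ] (ω : σ → ℂ)
    (k : ℕ) :
    (k : ℂ) * ((-1) ^ k * aeval ω (esymm σ ℂ k)) =
      ∑ a ∈ HasAntidiagonal.antidiagonal k with a.1 < k,
        ((-1) ^ a.1 * aeval ω (esymm σ ℂ a.1)) * (- ∑ i, ω i ^ a.2) := by
  have h := congrArg (aeval ω) (MvPolynomial.mul_esymm_eq_sum σ ℂ k)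
  simp only [map_mul, map_natCast, map_sum, map_pow, map_neg, map_one] at h
  rw [mul_left_comm, h, ← mul_assoc, pow_succ, mul_neg_one, mul_neg, ← mul_pow, neg_one_mul, neg_neg,
    one_pow, neg_one_mul, ← Finset.sum_neg_distrib]
  refine Finset.sum_congr rfl fun a _ => ?_
  rw [psum, map_sum]
  simp only [map_pow, aeval_X]
  ring

theorem Complex.exists_neg_one_pow_mul_esymm_eq {c : ℕ → ℂ} {D : ℕ} (hc0 : c 0 = 1)
    (hcD : ∀ d, D < d → c d = 0) :
    ∃ (s : Multiset ℂ), s.card = D ∧ ∀ d, c d = (-1) ^ d * s.esymm d := by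
  set Q : ℂ[X] := ∑ d ∈ Finset.range (D + 1), C (c d) * X ^ (D - d) with hQ
  have hcoeff : ∀ d ≤ D, Q.coeff (D - d) = c d := by
    intro d hd
    rw [hQ, finsetSum_coeff, Finset.sum_eq_single d]
    · simp
    · intro b hb hbd
      rw [Finset.mem_range] at hb
      rw [coeff_C_mul_X_pow, if_neg (by omega)]
    · intro h
      exact absurd (Finset.mem_range.2 (by omega)) h
  have hdeg : Q.natDegree ≤ D := by
    refine natDegree_sum_le_of_forall_le _ _ fun d _ => ?_
    exact (natDegree_C_mul_X_pow_le _ _).trans (Nat.sub_le _ _)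
  have hlead : Q.coeff D = 1 := by
    have := hcoeff 0 (Nat.zero_le _)
    rwa [Nat.sub_zero, hc0] at this
  have hdeg' : Q.natDegree = D := le_antisymm hdeg (le_natDegree_of_ne_zero (by
    rw [hlead]; exact one_ne_zero))
  have hcard : Q.roots.card = Q.natDegree :=
    (splits_iff_card_roots.1 (IsAlgClosed.splits Q))
  refine ⟨Q.roots, hcard.trans hdeg', fun d => ?_⟩
  rcases le_or_gt d D with hd | hd
  · rw [← hcoeff d hd, Polynomial.coeff_eq_esymm_roots_of_card hcard (by omega), leadingCoeff, hdeg',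
      hlead, Nat.sub_sub_self hd, one_mul]
  · rw [hcD d hd, Multiset.esymm, Multiset.powersetCard_eq_empty _ (by omega)]
    simp

theorem Complex.norm_coeff_one_le_of_newton {c S : ℕ → ℂ} {D : ℕ} (hc0 : c 0 = 1)
    (hcD : ∀ d, D < d → c d = 0)
    (hN : ∀ d : ℕ, (d : ℂ) * c d = ∑ a ∈ HasAntidiagonal.antidiagonal d with a.1 < d, c a.1 * S a.2)
    {B R : ℝ} (hR : 0 < R) {n₀ : ℕ} (hS : ∀ n ≥ n₀, ‖S (2 * n)‖ ≤ B * R ^ n) :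
    ‖c 1‖ ≤ D * √R := by
  classical
  obtain ⟨s, hs, hcs⟩ := Complex.exists_neg_one_pow_mul_esymm_eq hc0 hcD
  set ω : s → ℂ := fun x => (x : ℂ) with hω
  have hce : ∀ d, c d = (-1) ^ d * MvPolynomial.aeval ω (MvPolynomial.esymm s ℂ d) := by
    intro d
    rw [hcs, MvPolynomial.aeval_esymm_eq_multiset_esymm, Multiset.map_univ_coe]
  have hpow : ∀ k, 0 < k → S k = - ∑ i, ω i ^ k := by
    intro k
    induction k using Nat.strong_induction_on with
    | _ k ih =>
      intro hk
      have h1 := hN k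
      have h2 := MvPolynomial.neg_one_pow_mul_esymm_eq_sum ω k
      simp only [← hce] at h2
      rw [h1] at h2
      have hmem : ((0, k) : ℕ × ℕ) ∈ (HasAntidiagonal.antidiagonal k).filter (fun a => a.1 < k) := by
        simp [hk]
      rw [← Finset.add_sum_erase _ _ hmem, ← Finset.add_sum_erase _ _ hmem] at h2
      have h3 : ∀ a ∈ ((HasAntidiagonal.antidiagonal k).filter (fun a => a.1 < k)).erase (0, k),
          c a.1 * S a.2 = c a.1 * - ∑ i, ω i ^ a.2 := by
        intro a ha
        rw [Finset.mem_erase, Finset.mem_filter, HasAntidiagonal.mem_antidiagonal] at ha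
        have h4 : a.1 ≠ 0 := fun h0 => ha.1 (Prod.ext h0 (by
          have := ha.2.1
          simp only
          omega))
        rw [ih a.2 (by omega) (by omega)]
      rw [Finset.sum_congr rfl h3] at h2
      simpa [hc0] using add_right_cancel h2
  have hα : ∀ i, ‖ω i‖ ≤ √R := by
    intro i
    have h1 := Complex.norm_le_of_norm_powerSum_le (fun i => ω i ^ 2) hR (B := B) (n₀ := n₀ + 1)
      (fun n hn => by
        have h2 := hS n (by omega)
        rw [hpow (2 * n) (by omega), norm_neg] at h2
        simpa only [← pow_mul] using h2) i
    rw [norm_pow] at h1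
    exact Real.le_sqrt_of_sq_le h1
  have hc1 : c 1 = - ∑ i, ω i := by
    have h1 := hN 1
    have h2 : (HasAntidiagonal.antidiagonal 1).filter (fun a : ℕ × ℕ => a.1 < 1) = {(0, 1)} := by decide
    rw [h2, Finset.sum_singleton, hc0, hpow 1 one_pos] at h1
    simpa using h1
  rw [hc1, norm_neg]
  refine (norm_sum_le _ _).trans ((Finset.sum_le_sum fun i _ => hα i).trans (le_of_eq ?_))
  rw [Finset.sum_const, Finset.card_univ, Multiset.card_coe, hs, nsmul_eq_mul]

theorem Polynomial.finite_setOf_monic_natDegree_eq (F : Type*) [Field F] [Finite F] (d : ℕ) :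
    {g : F[X] | g.Monic ∧ g.natDegree = d}.Finite := by
  have : Finite (degreeLT F d) := Finite.of_equiv _ (degreeLTEquiv F d).toEquiv.symm
  exact Finite.of_equiv _ (monicEquivDegreeLT d).symm

/-- The monic polynomials of degree `d` over a finite field. -/
noncomputable def Polynomial.monicsOfDegree (F : Type*) [Field F] [Finite F] (d : ℕ) :
    Finset F[X] :=
  (finite_setOf_monic_natDegree_eq F d).toFinset

theorem Polynomial.mem_monicsOfDegree {F : Type*} [Field F] [Finite F] {d : ℕ} {g : F[X]} :
    g ∈ monicsOfDegree F d ↔ g.Monic ∧ g.natDegree = d := by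
  simp [monicsOfDegree]

open Classical in
/-- The monic irreducible polynomials of degree at most `d` over a finite field. -/
noncomputable def Polynomial.monicIrreducibles (F : Type*) [Field F] [Finite F] (d : ℕ) :
    Finset F[X] :=
  ((Finset.range (d + 1)).biUnion (monicsOfDegree F)).filter Irreducible

theorem Polynomial.mem_monicIrreducibles {F : Type*} [Field F] [Finite F] {d : ℕ} {P : F[X]} :
    P ∈ monicIrreducibles F d ↔ P.Monic ∧ Irreducible P ∧ P.natDegree ≤ d := by
  classical
  simp only [monicIrreducibles, Finset.mem_filter, Finset.mem_biUnion, Finset.mem_range,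
    mem_monicsOfDegree]
  constructor
  · rintro ⟨⟨m, hm, h1, rfl⟩, h2⟩
    exact ⟨h1, h2, by omega⟩
  · rintro ⟨h1, h2, h3⟩
    exact ⟨⟨_, by omega, h1, rfl⟩, h2⟩

open Classical in
theorem Polynomial.sum_monicIrreducibles_pow_dvd {F : Type*} [Field F] [Finite F] {d : ℕ} {g : F[X]}
    (hg : g.Monic) (hd : g.natDegree = d) :
    ∑ P ∈ monicIrreducibles F d, ∑ j ∈ Finset.Icc 1 d, (if P ^ j ∣ g then P.natDegree else 0) = d := by
  set s := UniqueFactorizationMonoid.normalizedFactors g with hs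
  have hprod : s.prod = g := by
    rw [hs, UniqueFactorizationMonoid.prod_normalizedFactors_eq hg.ne_zero, hg.normalize_eq_self]
  have hmonic : ∀ P ∈ s, P.Monic := fun P hP =>
    Polynomial.monic_normalize (UniqueFactorizationMonoid.irreducible_of_normalized_factor P hP).ne_zero
      |> fun h => by
        rwa [UniqueFactorizationMonoid.normalize_normalized_factor P hP] at h
  have hdvd : ∀ P ∈ monicIrreducibles F d, ∀ j, P ^ j ∣ g ↔ j ≤ s.count P := by
    intro P hP j
    rw [mem_monicIrreducibles] at hP
    rw [pow_dvd_iff_le_emultiplicity,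
      UniqueFactorizationMonoid.emultiplicity_eq_count_normalizedFactors hP.2.1 hg.ne_zero,
      hP.1.normalize_eq_self, Nat.cast_le]
  have hsub : s.toFinset ⊆ monicIrreducibles F d := by
    intro P hP
    rw [Multiset.mem_toFinset] at hP
    refine mem_monicIrreducibles.2 ⟨hmonic P hP,
      UniqueFactorizationMonoid.irreducible_of_normalized_factor P hP, ?_⟩
    rw [← hd]
    exact natDegree_le_of_dvd (UniqueFactorizationMonoid.dvd_of_mem_normalizedFactors hP) hg.ne_zero
  have hdeg : d = ∑ P ∈ s.toFinset, s.count P * P.natDegree := by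
    have h1 := natDegree_multiset_prod_of_monic s hmonic
    rw [hprod, hd, Finset.sum_multiset_map_count] at h1
    simpa using h1
  rw [Finset.sum_subset hsub (fun P _ hP => by
    rw [Multiset.mem_toFinset] at hP
    rw [Multiset.count_eq_zero_of_notMem hP, zero_mul])] at hdeg
  refine Eq.trans (Finset.sum_congr rfl fun P hP => ?_) hdeg.symm
  rw [← Finset.sum_filter, Finset.sum_const, smul_eq_mul]
  congr 1
  have hP' := mem_monicIrreducibles.1 hP
  have hle : s.count P ≤ d := by
    have h1 := natDegree_le_of_dvd ((hdvd P hP _).2 le_rfl) hg.ne_zero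
    rw [natDegree_pow, hd] at h1
    exact (Nat.le_mul_of_pos_right _ hP'.2.1.natDegree_pos).trans h1
  have h2 : (Finset.Icc 1 d).filter (fun j => P ^ j ∣ g) = Finset.Icc 1 (s.count P) := by
    ext j
    simp only [Finset.mem_filter, Finset.mem_Icc, hdvd P hP]
    omega
  rw [h2, Nat.card_Icc, Nat.add_sub_cancel]

open Classical in
theorem Polynomial.sum_monicsOfDegree_filter_dvd {F : Type*} [Field F] [Finite F] (ψ : F[X] →* ℂ)
    (d : ℕ) {h : F[X]} (hh : h.Monic) :
    ∑ g ∈ monicsOfDegree F d with h ∣ g, ψ g =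
      if h.natDegree ≤ d then ψ h * ∑ g ∈ monicsOfDegree F (d - h.natDegree), ψ g else 0 := by
  split_ifs with hd
  · rw [Finset.mul_sum]
    symm
    refine Finset.sum_bij (fun g _ => h * g) (fun g hg => ?_) (fun g₁ _ g₂ _ h12 => ?_)
      (fun g hg => ?_) (fun g _ => (map_mul _ _ _).symm)
    · rw [mem_monicsOfDegree] at hg
      rw [Finset.mem_filter, mem_monicsOfDegree, hh.natDegree_mul hg.1, hg.2]
      exact ⟨⟨hh.mul hg.1, by omega⟩, dvd_mul_right _ _⟩
    · exact mul_left_cancel₀ hh.ne_zero h12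
    · rw [Finset.mem_filter, mem_monicsOfDegree] at hg
      obtain ⟨⟨hg1, hg2⟩, q, rfl⟩ := hg
      have hq : q.Monic := hh.of_mul_monic_left hg1
      rw [hh.natDegree_mul hq] at hg2
      exact ⟨q, mem_monicsOfDegree.2 ⟨hq, by omega⟩, rfl⟩
  · refine Finset.sum_eq_zero fun g hg => ?_
    rw [Finset.mem_filter, mem_monicsOfDegree] at hg
    have h1 := natDegree_le_of_dvd hg.2 hg.1.1.ne_zero
    omega

open Classical in
theorem Polynomial.natCast_mul_sum_monicsOfDegree {F : Type*} [Field F] [Finite F] (ψ : F[X] →* ℂ)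
    (d : ℕ) :
    (d : ℂ) * ∑ g ∈ monicsOfDegree F d, ψ g =
      ∑ a ∈ HasAntidiagonal.antidiagonal d with a.1 < d, (∑ g ∈ monicsOfDegree F a.1, ψ g) *
        ∑ P ∈ monicIrreducibles F a.2 with P.natDegree ∣ a.2,
          (P.natDegree : ℂ) * ψ P ^ (a.2 / P.natDegree) := by
  set c : ℕ → ℂ := fun d => ∑ g ∈ monicsOfDegree F d, ψ g with hc
  have hleft : (d : ℂ) * c d = ∑ P ∈ monicIrreducibles F d, ∑ j ∈ Finset.Icc 1 d,
      if j * P.natDegree ≤ d then (P.natDegree : ℂ) * ψ P ^ j * c (d - j * P.natDegree) else 0 := by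
    have h1 : (d : ℂ) * c d = ∑ g ∈ monicsOfDegree F d, ∑ P ∈ monicIrreducibles F d,
        ∑ j ∈ Finset.Icc 1 d, (P.natDegree : ℂ) * (if P ^ j ∣ g then ψ g else 0) := by
      rw [hc, Finset.mul_sum]
      refine Finset.sum_congr rfl fun g hg => ?_
      rw [mem_monicsOfDegree] at hg
      have h2 := congrArg (Nat.cast (R := ℂ)) (sum_monicIrreducibles_pow_dvd hg.1 hg.2)
      rw [← h2]
      push_cast
      simp only [Finset.sum_mul]
      refine Finset.sum_congr rfl fun P _ => Finset.sum_congr rfl fun j _ => ?_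
      split_ifs <;> simp
    rw [h1, Finset.sum_comm]
    refine Finset.sum_congr rfl fun P hP => ?_
    rw [Finset.sum_comm]
    refine Finset.sum_congr rfl fun j _ => ?_
    have hPm := (mem_monicIrreducibles.1 hP).1
    rw [← Finset.mul_sum, ← Finset.sum_filter, sum_monicsOfDegree_filter_dvd ψ d (hPm.pow j),
      natDegree_pow, map_pow]
    split_ifs <;> simp [mul_assoc, hc]
  rw [hleft]
  have hright : ∑ a ∈ HasAntidiagonal.antidiagonal d with a.1 < d, c a.1 *
        (∑ P ∈ monicIrreducibles F a.2 with P.natDegree ∣ a.2,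
          (P.natDegree : ℂ) * ψ P ^ (a.2 / P.natDegree)) =
      ∑ k ∈ Finset.Icc 1 d, ∑ P ∈ monicIrreducibles F d,
        if P.natDegree ∣ k then (P.natDegree : ℂ) * ψ P ^ (k / P.natDegree) * c (d - k) else 0 := by
    refine Finset.sum_bij (fun a _ => a.2) (fun a ha => ?_) (fun a ha b hb hab => ?_)
      (fun k hk => ?_) (fun a ha => ?_)
    · rw [Finset.mem_filter, HasAntidiagonal.mem_antidiagonal] at ha
      rw [Finset.mem_Icc]
      omega
    · rw [Finset.mem_filter, HasAntidiagonal.mem_antidiagonal] at ha hb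
      exact Prod.ext (by omega) hab
    · rw [Finset.mem_Icc] at hk
      exact ⟨(d - k, k), by rw [Finset.mem_filter, HasAntidiagonal.mem_antidiagonal]; simp only; omega,
        rfl⟩
    · rw [Finset.mem_filter, HasAntidiagonal.mem_antidiagonal] at ha
      rw [← Finset.sum_filter, Finset.mul_sum]
      have h1 : (monicIrreducibles F a.2).filter (fun P => P.natDegree ∣ a.2) =
          (monicIrreducibles F d).filter (fun P => P.natDegree ∣ a.2) := by
        ext P
        simp only [Finset.mem_filter, mem_monicIrreducibles]
        constructor
        · rintro ⟨⟨h1, h2, h3⟩, h4⟩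
          exact ⟨⟨h1, h2, by omega⟩, h4⟩
        · rintro ⟨⟨h1, h2, h3⟩, h4⟩
          exact ⟨⟨h1, h2, Nat.le_of_dvd (by omega) h4⟩, h4⟩
      rw [h1]
      refine Finset.sum_congr rfl fun P _ => ?_
      rw [show d - a.2 = a.1 by omega]
      ring
  rw [hright]
  conv_rhs => rw [Finset.sum_comm]
  refine Finset.sum_congr rfl fun P hP => ?_
  have hpos := (mem_monicIrreducibles.1 hP).2.1.natDegree_pos
  rw [← Finset.sum_filter, ← Finset.sum_filter]
  refine Finset.sum_bij (fun j _ => j * P.natDegree) (fun j hj => ?_) (fun i _ j _ hij => ?_)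
    (fun k hk => ?_) (fun j _ => ?_)
  · rw [Finset.mem_filter, Finset.mem_Icc] at hj ⊢
    exact ⟨⟨Nat.mul_pos (by omega) hpos, hj.2⟩, dvd_mul_left _ _⟩
  · exact Nat.eq_of_mul_eq_mul_right hpos hij
  · rw [Finset.mem_filter, Finset.mem_Icc] at hk
    obtain ⟨⟨h1, h2⟩, j, rfl⟩ := hk
    refine ⟨j, ?_, mul_comm _ _⟩
    rw [Finset.mem_filter, Finset.mem_Icc, mul_comm j]
    exact ⟨⟨Nat.pos_of_mul_pos_left h1, (Nat.le_mul_of_pos_left _ hpos).trans h2⟩, h2⟩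
  · rw [Nat.mul_div_cancel _ hpos]

theorem PowerBasis.norm_algebraMap_sub_gen {R S : Type*} [CommRing R] [CommRing S] [Algebra R S]
    (pb : PowerBasis R S) (v : R) :
    Algebra.norm R (algebraMap R S v - pb.gen) = (minpoly R pb.gen).eval v := by
  classical
  rw [Algebra.norm_eq_matrix_det pb.basis, map_sub, ← charpoly_leftMulMatrix, Matrix.eval_charpoly,
    AlgHom.commutes]
  rfl

theorem Algebra.norm_algebraMap_sub {F K : Type*} [Field F] [Field K] [Algebra F K]
    [FiniteDimensional F K] (x : K) (v : F) :
    Algebra.norm F (algebraMap F K v - x) =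
      (minpoly F x).eval v ^ (Module.finrank F K / (minpoly F x).natDegree) := by
  have hx : IsIntegral F x := Algebra.IsIntegral.isIntegral x
  have hdim : Module.finrank F K / (minpoly F x).natDegree =
      Module.finrank (IntermediateField.adjoin F {x}) K := by
    rw [← IntermediateField.adjoin.finrank hx,
      ← Module.finrank_mul_finrank F (IntermediateField.adjoin F {x}) K,
      Nat.mul_div_cancel_left _ Module.finrank_pos]
  have h1 := PowerBasis.norm_algebraMap_sub_gen (IntermediateField.adjoin.powerBasis hx) v
  rw [IntermediateField.adjoin.powerBasis_gen hx, IntermediateField.minpoly_gen] at h1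
  rw [hdim, ← h1, ← map_pow, ← Algebra.norm_algebraMap, Algebra.norm_norm]
  rfl

open Classical in
theorem FiniteField.card_filter_minpoly_eq {F K : Type*} [Field F] [Field K] [Algebra F K] [Finite F]
    [Fintype K] [FiniteDimensional F K] {P : F[X]} (hP : P.Monic) (hirr : Irreducible P)
    (hdvd : P.natDegree ∣ Module.finrank F K) : #{x : K | minpoly F x = P} = P.natDegree := by
  have hcard : Nat.card K = Nat.card F ^ Module.finrank F K := Module.natCard_eq_pow_finrank
  have hsplit : (P.map (algebraMap F K)).Splits := by
    have h1 : (X ^ Nat.card K - X : K[X]).Splits := Polynomial.splits_X_pow_nat_card_sub_X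
    refine h1.of_dvd ?_ ?_
    · exact FiniteField.X_pow_card_sub_X_ne_zero K Finite.one_lt_card
    · have h2 := Polynomial.map_dvd (algebraMap F K)
        (hirr.natDegree_dvd_iff_dvd_X_pow_card_pow_sub_X.1 hdvd)
      rwa [← hcard, Polynomial.map_sub, Polynomial.map_pow, map_X] at h2
  have hsep : P.Separable := PerfectField.separable_of_irreducible hirr
  rw [← Polynomial.card_rootSet_eq_natDegree hsep hsplit, ← Set.toFinset_card]
  congr 1
  ext x
  rw [Set.mem_toFinset, Polynomial.mem_rootSet]
  simp only [Finset.mem_filter, Finset.mem_univ, true_and]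
  constructor
  · rintro rfl
    exact ⟨hP.ne_zero, minpoly.aeval F x⟩
  · rintro ⟨_, h⟩
    exact (minpoly.eq_of_irreducible_of_monic hirr h hP).symm

/-- The product `∏ χ(g(v)) ^ e(v)` over `v ∈ V`, as a multiplicative function of `g`. -/
noncomputable def MulChar.evalProd {F : Type*} [Field F] (χ : MulChar F ℂ) (V : Finset F)
    (e : F → ℕ) : F[X] →* ℂ where
  toFun g := ∏ v ∈ V, χ (g.eval v) ^ e v
  map_one' := by simp
  map_mul' g h := by simp only [eval_mul, map_mul, mul_pow, Finset.prod_mul_distrib]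

theorem MulChar.evalProd_apply {F : Type*} [Field F] (χ : MulChar F ℂ) (V : Finset F)
    (e : F → ℕ) (g : F[X]) : χ.evalProd V e g = ∏ v ∈ V, χ (g.eval v) ^ e v := rfl

open Classical in
theorem MulChar.sum_prod_norm_pow_eq {F K : Type*} [Field F] [Field K] [Algebra F K] [Finite F]
    [Fintype K] [FiniteDimensional F K] (χ : MulChar F ℂ) (V : Finset F) (e : F → ℕ) {k : ℕ}
    (hk : Module.finrank F K = k) :
    ∑ P ∈ monicIrreducibles F k with P.natDegree ∣ k,
        (P.natDegree : ℂ) * χ.evalProd V e P ^ (k / P.natDegree) =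
      ∑ x : K, ∏ v ∈ V, (χ (Algebra.norm F (algebraMap F K v - x))) ^ e v := by
  have hmaps : ∀ x ∈ (Finset.univ : Finset K),
      minpoly F x ∈ (monicIrreducibles F k).filter (fun P => P.natDegree ∣ k) := by
    intro x _
    have hx : IsIntegral F x := Algebra.IsIntegral.isIntegral x
    rw [Finset.mem_filter, mem_monicIrreducibles]
    refine ⟨⟨minpoly.monic hx, minpoly.irreducible hx, ?_⟩, ?_⟩
    · rw [← hk]
      exact minpoly.natDegree_le x
    · rw [← hk]
      exact minpoly.degree_dvd hx
  rw [← Finset.sum_fiberwise_of_maps_to hmaps]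
  refine Finset.sum_congr rfl fun P hP => ?_
  rw [Finset.mem_filter, mem_monicIrreducibles] at hP
  rw [Finset.sum_congr rfl (g := fun _ => χ.evalProd V e P ^ (k / P.natDegree)) (fun x hx => ?_),
    Finset.sum_const, FiniteField.card_filter_minpoly_eq hP.1.1 hP.1.2.1 (hk ▸ hP.2), nsmul_eq_mul]
  rw [MulChar.evalProd_apply, ← Finset.prod_pow]
  refine Finset.prod_congr rfl fun v _ => ?_
  rw [Algebra.norm_algebraMap_sub, (Finset.mem_filter.1 hx).2, hk, map_pow, pow_right_comm]

theorem MulChar.sum_evalProd_monicsOfDegree_eq_zero {F : Type*} [Field F] [Finite F]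
    (χ : MulChar F ℂ) {V : Finset F} {e : F → ℕ} (hV : ∃ v ∈ V, χ ^ e v ≠ 1) {d : ℕ}
    (hd : #V ≤ d) : ∑ g ∈ monicsOfDegree F d, χ.evalProd V e g = 0 := by
  classical
  have := Fintype.ofFinite F
  obtain ⟨v₀, hv₀, hne⟩ := hV
  have he0 : e v₀ ≠ 0 := fun h => hne (by rw [h, pow_zero])
  set h : F[X] := ∏ v ∈ V.erase v₀, (X - C v) with hh
  have hh0 : h.eval v₀ ≠ 0 := by
    rw [hh, eval_prod, Finset.prod_ne_zero_iff]
    intro v hv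
    rw [eval_sub, eval_X, eval_C, sub_ne_zero]
    exact (Finset.ne_of_mem_erase hv).symm
  have hhv : ∀ v ∈ V.erase v₀, h.eval v = 0 := by
    intro v hv
    rw [hh, eval_prod]
    exact Finset.prod_eq_zero hv (by simp)
  have hdeg : h.natDegree < d := by
    rw [hh, natDegree_prod_of_monic _ _ fun v _ => monic_X_sub_C v]
    simp only [natDegree_X_sub_C, Finset.sum_const, smul_eq_mul, mul_one]
    rw [Finset.card_erase_of_mem hv₀]
    have := Finset.card_pos.2 ⟨v₀, hv₀⟩
    omega
  have hmem : ∀ t : F, ∀ g ∈ monicsOfDegree F d, g + C t * h ∈ monicsOfDegree F d := by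
    intro t g hg
    rw [mem_monicsOfDegree] at hg ⊢
    have h1 : (C t * h).natDegree < g.natDegree := by
      rw [hg.2]
      exact (natDegree_C_mul_le _ _).trans_lt hdeg
    exact ⟨hg.1.add_of_left (degree_lt_degree h1), by
      rw [natDegree_add_eq_left_of_natDegree_lt h1, hg.2]⟩
  have htrans : ∀ t : F, ∑ g ∈ monicsOfDegree F d, χ.evalProd V e g =
      ∑ g ∈ monicsOfDegree F d, χ.evalProd V e (g + C t * h) := by
    intro t
    symm
    refine Finset.sum_bij (fun g _ => g + C t * h) (fun g hg => hmem t g hg)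
      (fun g₁ _ g₂ _ h12 => add_right_cancel h12) (fun g hg => ?_) (fun _ _ => rfl)
    refine ⟨g + C (-t) * h, hmem (-t) g hg, ?_⟩
    rw [C_neg]
    ring
  have hsum : ∀ g : F[X], ∑ t : F, χ.evalProd V e (g + C t * h) = 0 := by
    intro g
    have h1 : ∀ t, χ.evalProd V e (g + C t * h) =
        (χ ^ e v₀) (g.eval v₀ + t * h.eval v₀) * ∏ v ∈ V.erase v₀, χ (g.eval v) ^ e v := by
      intro t
      rw [MulChar.evalProd_apply, ← Finset.mul_prod_erase V _ hv₀, MulChar.pow_apply' _ he0]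
      simp only [eval_add, eval_mul, eval_C]
      congr 1
      refine Finset.prod_congr rfl fun v hv => ?_
      rw [hhv v hv, mul_zero, add_zero]
    simp only [h1]
    rw [← Finset.sum_mul]
    have h2 : ∑ t : F, (χ ^ e v₀) (g.eval v₀ + t * h.eval v₀) = 0 := by
      rw [← MulChar.sum_eq_zero_of_ne_one hne]
      exact ((Equiv.mulRight₀ _ hh0).trans (Equiv.addLeft (g.eval v₀))).sum_comp (χ ^ e v₀)
    rw [h2, zero_mul]
  have hfin : (Fintype.card F : ℂ) * ∑ g ∈ monicsOfDegree F d, χ.evalProd V e g = 0 := by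
    rw [← nsmul_eq_mul, ← Finset.card_univ, ← Finset.sum_const,
      Finset.sum_congr rfl (fun t _ => htrans t), Finset.sum_comm]
    exact Finset.sum_eq_zero fun g _ => hsum g
  exact (mul_eq_zero.1 hfin).resolve_left (by exact_mod_cast Fintype.card_ne_zero)

theorem MulChar.sum_evalProd_monicsOfDegree_one {F : Type*} [Field F] [Fintype F]
    (χ : MulChar F ℂ) (V : Finset F) (e : F → ℕ) :
    ∑ g ∈ monicsOfDegree F 1, χ.evalProd V e g = ∑ u, ∏ v ∈ V, χ (u + v) ^ e v := by
  symm
  refine Finset.sum_bij (fun u _ => X + C u) (fun u _ => ?_) (fun u _ v _ huv => ?_) (fun g hg => ?_)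
    (fun u _ => ?_)
  · exact mem_monicsOfDegree.2 ⟨monic_X_add_C u, natDegree_X_add_C u⟩
  · exact C_injective (add_left_cancel huv)
  · rw [mem_monicsOfDegree] at hg
    exact ⟨g.coeff 0, Finset.mem_univ _, (hg.1.eq_X_add_C hg.2).symm⟩
  · rw [MulChar.evalProd_apply]
    refine Finset.prod_congr rfl fun v _ => ?_
    rw [eval_add, eval_X, eval_C, add_comm]

theorem MulChar.orderOf_dvd_card_pow_sub_one {F : Type*} [Field F] [Fintype F] (χ : MulChar F ℂ)
    (n : ℕ) : orderOf χ ∣ Fintype.card F ^ n - 1 := by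
  have h : orderOf χ ∣ Fintype.card F - 1 := by
    classical
    rw [orderOf_dvd_iff_pow_eq_one]
    ext a
    rw [MulChar.pow_apply_coe, MulChar.one_apply_coe, ← map_pow, ← Units.val_pow_eq_pow_val,
      ← Fintype.card_units, pow_card_eq_one, Units.val_one, map_one]
  exact h.trans (by simpa using Nat.sub_dvd_pow_sub_pow (Fintype.card F) 1 n)

open Classical in
theorem MulChar.norm_sum_monicIrreducibles_le {F K : Type*} [Field F] [Fintype F] [Field K]
    [Algebra F K] [FiniteDimensional F K] (χ : MulChar F ℂ) {V : Finset F} {e : F → ℕ}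
    (hV : ∃ v ∈ V, χ ^ e v ≠ 1) {n : ℕ} (hn : 2 * orderOf χ * (∑ v ∈ V, e v) + 5 ≤ n)
    (hK : Module.finrank F K = 2 * n) :
    ‖∑ P ∈ monicIrreducibles F (2 * n) with P.natDegree ∣ 2 * n,
        (P.natDegree : ℂ) * χ.evalProd V e P ^ (2 * n / P.natDegree)‖ ≤
      (2 * orderOf χ * (4 * (∑ v ∈ V, e v : ℕ) + 3) + (∑ v ∈ V, e v : ℕ)) *
        (Fintype.card F : ℝ) ^ n := by
  have : Finite K := Module.finite_of_finite F
  have : Fintype K := Fintype.ofFinite K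
  have hcard : Fintype.card K = (Fintype.card F ^ n) ^ 2 := by
    rw [Module.card_eq_pow_finrank (K := F), hK, ← pow_mul, mul_comm]
  have hlt : n < Fintype.card F ^ n := Nat.lt_pow_self Fintype.one_lt_card
  rw [MulChar.sum_prod_norm_pow_eq (K := K) χ V e hK, ← Nat.cast_pow]
  refine MulChar.norm_sum_compNorm_le_of_large χ hV hcard (χ.orderOf_dvd_card_pow_sub_one n) ?_
  generalize ∑ v ∈ V, e v = E at *
  generalize Fintype.card F ^ n = s at *
  generalize 2 * orderOf χ * E = y at *
  nlinarith

/-- **Weil's bound** for multiplicative character sums of products of linear factors. -/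
theorem MulChar.norm_sum_prod_pow_le {F : Type*} [Field F] [Fintype F] (χ : MulChar F ℂ)
    {V : Finset F} {e : F → ℕ} (hV : ∃ v ∈ V, χ ^ e v ≠ 1) :
    ‖∑ u, ∏ v ∈ V, χ (u + v) ^ e v‖ ≤ (#V - 1 : ℕ) * √(Fintype.card F) := by
  classical
  rw [← MulChar.sum_evalProd_monicsOfDegree_one]
  set E := ∑ v ∈ V, e v with hE
  set q := Fintype.card F with hq
  have hq1 : 1 < q := Fintype.one_lt_card
  have hVpos : 0 < #V := by
    obtain ⟨v, hv, _⟩ := hV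
    exact Finset.card_pos.2 ⟨v, hv⟩
  refine Complex.norm_coeff_one_le_of_newton
    (c := fun d => ∑ g ∈ monicsOfDegree F d, χ.evalProd V e g)
    (S := fun k => ∑ P ∈ monicIrreducibles F k with P.natDegree ∣ k,
      (P.natDegree : ℂ) * χ.evalProd V e P ^ (k / P.natDegree)) ?_ (fun d hd => ?_)
    (fun d => natCast_mul_sum_monicsOfDegree (χ.evalProd V e) d) (R := q)
    (B := 2 * orderOf χ * (4 * (E : ℕ) + 3) + (E : ℕ)) (by positivity)
    (n₀ := 2 * orderOf χ * E + 5) (fun n hn => ?_)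
  · have h1 : monicsOfDegree F 0 = {1} := by
      ext g
      rw [mem_monicsOfDegree, Finset.mem_singleton]
      constructor
      · rintro ⟨h1, h2⟩
        exact h1.natDegree_eq_zero.1 h2
      · rintro rfl
        exact ⟨monic_one, natDegree_one⟩
    simp only [h1, Finset.sum_singleton, map_one]
  · exact χ.sum_evalProd_monicsOfDegree_eq_zero hV (by omega)
  · obtain ⟨p, hp⟩ := CharP.exists F
    have : Fact p.Prime := ⟨CharP.char_is_prime F p⟩
    have : NeZero (2 * n) := ⟨by omega⟩
    exact MulChar.norm_sum_monicIrreducibles_le (K := FiniteField.Extension F p (2 * n)) χ hV hn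
      (FiniteField.finrank_extension F p (2 * n))

/-- The number of functions `Fin n → α` that take none of their values exactly once. -/
noncomputable def noSingletonFiberCount (α : Type*) (n : ℕ) : ℕ :=
  Nat.card {f : Fin n → α // ∀ i, ∃ j, j ≠ i ∧ f j = f i}

theorem noSingletonFiberCount_add_two_le (α : Type*) [Finite α] (n : ℕ) :
    noSingletonFiberCount α (n + 2) ≤ (n + 1) *
      (Nat.card α * noSingletonFiberCount α n + noSingletonFiberCount α (n + 1)) := by
  classical
  set G : (m : ℕ) → Set (Fin m → α) := fun m => {f | ∀ i, ∃ j, j ≠ i ∧ f j = f i} with hG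
  have hinj : ∃ φ : G (n + 2) → Fin (n + 1) × ((α × G n) ⊕ G (n + 1)), Function.Injective φ := by
    have h1 : ∀ f : G (n + 2), ∃ y : Fin (n + 1) × ((α × G n) ⊕ G (n + 1)),
        f.1 0 = f.1 y.1.succ ∧
        (∀ z, y.2 = Sum.inl z → f.1 0 = z.1 ∧ z.2.1 = fun i => f.1 (y.1.succAbove i).succ) ∧
        (∀ z, y.2 = Sum.inr z → z.1 = fun i => f.1 i.succ) := by
      intro f
      obtain ⟨j, hj0, hj⟩ := f.2 0
      obtain ⟨j, rfl⟩ := Fin.exists_succ_eq.2 hj0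
      by_cases h : ∃ k, k ≠ j ∧ f.1 k.succ = f.1 0
      · obtain ⟨k, hkj, hk⟩ := h
        have hg : (fun i : Fin (n + 1) => f.1 i.succ) ∈ G (n + 1) := by
          intro i
          by_cases hi : f.1 i.succ = f.1 0
          · by_cases hij : i = j
            · exact ⟨k, by rwa [hij], hk.trans hi.symm⟩
            · exact ⟨j, fun h => hij h.symm, hj.trans hi.symm⟩
          · obtain ⟨l, hl, hli⟩ := f.2 i.succ
            have hl0 : l ≠ 0 := by
              rintro rfl
              exact hi hli.symm
            obtain ⟨l, rfl⟩ := Fin.exists_succ_eq.2 hl0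
            exact ⟨l, fun h => hl (by rw [h]), hli⟩
        exact ⟨(j, Sum.inr ⟨_, hg⟩), hj.symm, by simp, by rintro z hz; cases hz; rfl⟩
      · push Not at h
        have hg : (fun i : Fin n => f.1 (j.succAbove i).succ) ∈ G n := by
          intro i
          obtain ⟨l, hl, hli⟩ := f.2 (j.succAbove i).succ
          have hi := h _ (Fin.succAbove_ne j i)
          have hl0 : l ≠ 0 := by
            rintro rfl
            exact hi hli.symm
          obtain ⟨l, rfl⟩ := Fin.exists_succ_eq.2 hl0
          have hlj : l ≠ j := by
            rintro rfl
            exact hi (hli.symm.trans hj)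
          obtain ⟨l, rfl⟩ := Fin.exists_succAbove_eq hlj
          exact ⟨l, fun h => hl (by rw [h]), hli⟩
        exact ⟨(j, Sum.inl (f.1 0, ⟨_, hg⟩)), hj.symm, by rintro z hz; cases hz; exact ⟨rfl, rfl⟩,
          by simp⟩
    choose φ hφ0 hφl hφr using h1
    refine ⟨φ, fun f g hfg => Subtype.ext (funext fun i => ?_)⟩
    have hf0 := hφ0 f
    have hfl := hφl f
    have hfr := hφr f
    have hg0 := hφ0 g
    have hgl := hφl g
    have hgr := hφr g
    rw [hfg] at hf0 hfl hfr
    generalize φ g = y at hf0 hfl hfr hg0 hgl hgr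
    obtain ⟨j, z⟩ := y
    simp only at hf0 hfl hfr hg0 hgl hgr
    rcases z with z | z
    · have a1 := hfl z rfl
      have a2 := hgl z rfl
      have h0 : f.1 0 = g.1 0 := a1.1.trans a2.1.symm
      induction i using Fin.cases with
      | zero => exact h0
      | succ i =>
        by_cases hij : i = j
        · rw [hij, ← hf0, ← hg0, h0]
        · obtain ⟨l, rfl⟩ := Fin.exists_succAbove_eq hij
          exact congrFun (a1.2.symm.trans a2.2) l
    · have h0 : ∀ i : Fin (n + 1), f.1 i.succ = g.1 i.succ :=
        fun i => congrFun ((hfr z rfl).symm.trans (hgr z rfl)) i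
      induction i using Fin.cases with
      | zero => rw [hf0, hg0, h0]
      | succ i => exact h0 i
  obtain ⟨φ, hφ⟩ := hinj
  have h2 := Nat.card_le_card_of_injective φ hφ
  rwa [Nat.card_prod, Nat.card_sum, Nat.card_prod, Nat.card_fin] at h2

theorem one_sub_inv_pow_le (m : ℕ) : ((m + 1 : ℝ) / (m + 2)) ^ (m + 2) ≤ Real.exp (-1) := by
  have h1 : (m + 1 : ℝ) / (m + 2) ≤ Real.exp (-(1 / (m + 2))) := by
    have h2 := Real.add_one_le_exp (-(1 / (m + 2 : ℝ)))
    have h3 : (m + 1 : ℝ) / (m + 2) = -(1 / (m + 2)) + 1 := by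
      field_simp
      ring
    rwa [h3]
  refine (pow_le_pow_left₀ (by positivity) h1 _).trans (le_of_eq ?_)
  rw [← Real.exp_nat_mul]
  congr 1
  push_cast
  field_simp

theorem eight_mul_pow_le (m : ℕ) : 8 * (m + 1 : ℝ) ^ (m + 2) ≤ 3 * (m + 2) ^ (m + 2) := by
  have h := (one_sub_inv_pow_le m).trans Real.exp_neg_one_lt_d9.le
  rw [div_pow, div_le_iff₀ (by positivity)] at h
  have : (0 : ℝ) < (m + 2) ^ (m + 2) := by positivity
  linarith

theorem five_mul_pow_le (m : ℕ) :
    5 * ((2 * m + 3) * (m + 1 : ℝ) ^ (m + 1)) ≤ 4 * (m + 2) ^ (m + 2) := by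
  rcases lt_or_ge m 5 with hm | hm
  · interval_cases m <;> norm_num
  · have h := (one_sub_inv_pow_le m).trans Real.exp_neg_one_lt_d9.le
    rw [div_pow, div_le_iff₀ (by positivity)] at h
    have h0 : (0 : ℝ) < (m + 1) ^ (m + 1) := by positivity
    have hm' : (5 : ℝ) ≤ m := by exact_mod_cast hm
    rw [pow_succ] at h
    nlinarith

theorem noSingletonFiberCount_le (α : Type*) [Finite α] {r : ℕ} (hr : 2 * r ≤ Nat.card α) {m : ℕ}
    (hm : m + 1 ≤ r) :
    (noSingletonFiberCount α (2 * m + 2) : ℝ) ≤ (2 * (m + 1) * Nat.card α) ^ (m + 1) ∧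
    5 * ((noSingletonFiberCount α (2 * m + 1) : ℝ) * Nat.card α) ≤
      3 * (2 * (m + 1) * Nat.card α) ^ (m + 1) := by
  set J := Nat.card α with hJ
  have hrec : ∀ n, (noSingletonFiberCount α (n + 2) : ℝ) ≤ (n + 1) *
      (J * noSingletonFiberCount α n + noSingletonFiberCount α (n + 1)) := fun n => by
    exact_mod_cast noSingletonFiberCount_add_two_le α n
  have hone : noSingletonFiberCount α 1 = 0 := by
    rw [noSingletonFiberCount, Nat.card_eq_zero]
    left
    refine ⟨fun f => ?_⟩
    obtain ⟨j, hj, _⟩ := f.2 0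
    exact hj (Subsingleton.elim _ _)
  have hzero : noSingletonFiberCount α 0 = 1 := by
    rw [noSingletonFiberCount, Nat.card_eq_one_iff_unique]
    exact ⟨⟨fun f g => Subtype.ext (Subsingleton.elim _ _)⟩, ⟨⟨Fin.elim0, fun i => i.elim0⟩⟩⟩
  induction m with
  | zero =>
    have h := hrec 0
    simp only [zero_add, hone, hzero] at h ⊢
    have h0 : (0 : ℝ) ≤ J := by positivity
    push_cast at h ⊢
    refine ⟨by linarith, by linarith⟩
  | succ m ih =>
    obtain ⟨ih1, ih2⟩ := ih (by omega)
    have h1 := hrec (2 * m + 1)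
    have h2 := hrec (2 * m + 2)
    have hJm : (2 * m + 3 : ℝ) ≤ J := by exact_mod_cast (show 2 * m + 3 ≤ J by omega)
    have e1 : 2 * (m + 1) + 1 = 2 * m + 1 + 2 := by ring
    have e2 : 2 * (m + 1) + 2 = 2 * m + 2 + 2 := by ring
    have e3 : 2 * m + 1 + 1 = 2 * m + 2 := by ring
    have e4 : 2 * m + 2 + 1 = 2 * m + 1 + 2 := by ring
    rw [e1, e2]
    rw [e3] at h1
    rw [e4] at h2
    push_cast at h1 h2 ⊢
    set g1 := ((noSingletonFiberCount α (2 * m + 1) : ℕ) : ℝ)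
    set g2 := ((noSingletonFiberCount α (2 * m + 2) : ℕ) : ℝ)
    set g3 := ((noSingletonFiberCount α (2 * m + 1 + 2) : ℕ) : ℝ) with hg3
    set g4 := ((noSingletonFiberCount α (2 * m + 2 + 2) : ℕ) : ℝ)
    have hJ0 : (0 : ℝ) ≤ J := by positivity
    have hm0 : (0 : ℝ) ≤ m := by positivity
    have hg30 : 0 ≤ g3 := by rw [hg3]; positivity
    have hX : (2 * ((m : ℝ) + 1) * J) ^ (m + 1) = (2 * J) ^ (m + 1) * (m + 1) ^ (m + 1) := by
      rw [← mul_pow]; ring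
    have hY : (2 * ((m : ℝ) + 1 + 1) * J) ^ (m + 1 + 1) =
        (2 * J) * ((2 * J) ^ (m + 1) * (m + 2) ^ (m + 2)) := by
      rw [show (m : ℝ) + 1 + 1 = m + 2 by ring, show 2 * ((m : ℝ) + 2) * J = (2 * J) * (m + 2) by ring,
        mul_pow]
      ring
    have hP : (0 : ℝ) ≤ (2 * J) ^ (m + 1) := by positivity
    have k1 := mul_le_mul_of_nonneg_left (eight_mul_pow_le m) hP
    have k2 := mul_le_mul_of_nonneg_left (five_mul_pow_le m) hP
    rw [hX] at ih1 ih2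
    rw [hY]
    generalize (2 * (J : ℝ)) ^ (m + 1) = P at *
    rw [pow_succ _ (m + 1)] at k1
    generalize ((m : ℝ) + 1) ^ (m + 1) = Q at *
    generalize ((m : ℝ) + 2) ^ (m + 2) = R at *
    have h3 : 5 * (g3 * J) ≤ 3 * (2 * J * (P * R)) := by
      have a1 : 5 * g3 ≤ 8 * (2 * (m + 1)) * (P * Q) := by
        have a2 : 5 * (J * g1 + g2) ≤ 8 * (P * Q) := by linarith
        have a3 := mul_le_mul_of_nonneg_left a2 (show (0 : ℝ) ≤ 2 * (m + 1) by positivity)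
        linarith
      have a4 := mul_le_mul_of_nonneg_right a1 hJ0
      have a5 := mul_le_mul_of_nonneg_left k1 hJ0
      linarith
    refine ⟨?_, h3⟩
    have a6 : (2 * (m : ℝ) + 3) * g3 ≤ J * g3 := mul_le_mul_of_nonneg_right hJm hg30
    have a7 := mul_le_mul_of_nonneg_left ih1 (show (0 : ℝ) ≤ (2 * m + 3) * J by positivity)
    have a8 := mul_le_mul_of_nonneg_left k2 hJ0
    linarith

theorem MulChar.norm_apply_le_one {F : Type*} [Field F] [Finite F] (χ : MulChar F ℂ) (a : F) :
    ‖χ a‖ ≤ 1 := by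
  by_cases ha : a = 0
  · simp [ha]
  · refine (Complex.norm_eq_one_of_pow_eq_one (n := orderOf χ) ?_ (orderOf_pos χ).ne').le
    rw [← MulChar.pow_apply' _ (orderOf_pos χ).ne', pow_orderOf_eq_one,
      MulChar.one_apply (Ne.isUnit ha)]

theorem MulChar.conj_apply {F : Type*} [Field F] [Finite F] {χ : MulChar F ℂ} (hχ : χ ≠ 1) (a : F) :
    starRingEnd ℂ (χ a) = χ a ^ (orderOf χ - 1) := by
  have h0 := orderOf_pos χ
  have h1 : orderOf χ ≠ 1 := fun h => hχ (orderOf_eq_one_iff.1 h)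
  have h2 : χ⁻¹ = χ ^ (orderOf χ - 1) := by
    refine inv_eq_of_mul_eq_one_right ?_
    rw [← pow_succ', Nat.sub_add_cancel h0, pow_orderOf_eq_one]
  rw [← MulChar.pow_apply' _ (by omega : orderOf χ - 1 ≠ 0), ← h2]
  exact MulChar.star_apply' χ a

theorem MulChar.norm_sum_prod_comp_le {F ι : Type*} [Field F] [Fintype F] [Fintype ι]
    (χ : MulChar F ℂ) {τ : ι → F} {ε : ι → ℕ} {i : ι} (hε : χ ^ ε i ≠ 1)
    (hτ : ∀ j, j ≠ i → τ j ≠ τ i) :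
    ‖∑ u, ∏ j, χ (u + τ j) ^ ε j‖ ≤ (Fintype.card ι - 1 : ℕ) * √(Fintype.card F) := by
  classical
  set V := Finset.univ.image τ with hV
  set e : F → ℕ := fun v => ∑ j with τ j = v, ε j with he
  have h1 : ∀ u, ∏ j, χ (u + τ j) ^ ε j = ∏ v ∈ V, χ (u + v) ^ e v := by
    intro u
    rw [← Finset.prod_fiberwise_of_maps_to (s := Finset.univ) (t := V) (g := τ)
      (fun j _ => Finset.mem_image_of_mem τ (Finset.mem_univ j))]
    refine Finset.prod_congr rfl fun v _ => ?_
    rw [he, ← Finset.prod_pow_eq_pow_sum]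
    exact Finset.prod_congr rfl fun j hj => by rw [(Finset.mem_filter.1 hj).2]
  have h2 : e (τ i) = ε i := by
    have h3 : (Finset.univ.filter fun j => τ j = τ i) = {i} := by
      ext j
      simp only [Finset.mem_filter, Finset.mem_univ, true_and, Finset.mem_singleton]
      exact ⟨fun h => by_contra fun hj => hτ j hj h, fun h => by rw [h]⟩
    simp only [he, h3, Finset.sum_singleton]
  simp only [h1]
  refine (χ.norm_sum_prod_pow_le (V := V) (e := e)
    ⟨τ i, Finset.mem_image_of_mem τ (Finset.mem_univ i), by rwa [h2]⟩).trans ?_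
  have h4 : #V ≤ Fintype.card ι := Finset.card_image_le
  gcongr

theorem MulChar.sum_norm_sum_pow_le {F : Type*} [Field F] [Fintype F] {χ : MulChar F ℂ} (hχ : χ ≠ 1)
    (J : Finset F) (r : ℕ) :
    ∑ u, ‖∑ t ∈ J, χ (u + t)‖ ^ (2 * r) ≤
      noSingletonFiberCount J (2 * r) * Fintype.card F +
        (#J : ℝ) ^ (2 * r) * ((2 * r - 1 : ℕ) * √(Fintype.card F)) := by
  classical
  set q := Fintype.card F
  set d := orderOf χ with hd
  set ε : Fin (r + r) → ℕ := Fin.addCases (fun _ => 1) (fun _ => d - 1) with hε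
  have hε1 : ∀ i, χ ^ ε i ≠ 1 := by
    intro i
    induction i using Fin.addCases with
    | left i => simpa [hε] using hχ
    | right i =>
      have h0 := orderOf_pos χ
      simp only [hε, Fin.addCases_right]
      intro h
      have h' : χ ^ (d - 1) * χ = 1 := by
        rw [← pow_succ, Nat.sub_add_cancel h0, pow_orderOf_eq_one]
      rw [h, one_mul] at h'
      exact hχ h'
  have hexpand : ∀ u, ((‖∑ t ∈ J, χ (u + t)‖ ^ (2 * r) : ℝ) : ℂ) =
      ∑ τ : Fin (r + r) → J, ∏ i, χ (u + τ i) ^ ε i := by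
    intro u
    have h1 : ∀ i, (∑ t : J, χ (u + t) ^ ε i) =
        Fin.addCases (motive := fun _ => ℂ) (fun _ => ∑ t ∈ J, χ (u + t))
          (fun _ => starRingEnd ℂ (∑ t ∈ J, χ (u + t))) i := by
      intro i
      rw [Finset.sum_coe_sort J (fun t => χ (u + t) ^ ε i)]
      induction i using Fin.addCases with
      | left i => simp [hε]
      | right i => simp only [hε, Fin.addCases_right, map_sum, MulChar.conj_apply hχ, hd]
    rw [← Fintype.piFinset_univ, ← Finset.prod_univ_sum (fun _ : Fin (r + r) => (Finset.univ : Finset J))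
      (fun i t => χ (u + t) ^ ε i)]
    simp only [h1]
    rw [Fin.prod_univ_add]
    simp only [Fin.addCases_left, Fin.addCases_right, Finset.prod_const, Finset.card_univ,
      Fintype.card_fin]
    rw [← mul_pow, Complex.mul_conj, Complex.normSq_eq_norm_sq, pow_mul]
    push_cast
    rfl
  have hsum : ((∑ u, ‖∑ t ∈ J, χ (u + t)‖ ^ (2 * r) : ℝ) : ℂ) =
      ∑ τ : Fin (r + r) → J, ∑ u, ∏ i, χ (u + τ i) ^ ε i := by
    rw [Finset.sum_comm, Complex.ofReal_sum]
    exact Finset.sum_congr rfl fun u _ => hexpand u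
  have hnonneg : 0 ≤ ∑ u, ‖∑ t ∈ J, χ (u + t)‖ ^ (2 * r) :=
    Finset.sum_nonneg fun u _ => by positivity
  have hnorm : ∑ u, ‖∑ t ∈ J, χ (u + t)‖ ^ (2 * r) =
      ‖∑ τ : Fin (r + r) → J, ∑ u, ∏ i, χ (u + τ i) ^ ε i‖ := by
    rw [← hsum, Complex.norm_real, Real.norm_of_nonneg hnonneg]
  have hτ : ∀ τ : Fin (r + r) → J, ‖∑ u, ∏ i, χ (u + τ i) ^ ε i‖ ≤
      (if ∀ i, ∃ j, j ≠ i ∧ τ j = τ i then (q : ℝ) else 0) + (2 * r - 1 : ℕ) * √q := by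
    intro τ
    split_ifs with h
    · have h1 : ‖∑ u, ∏ i, χ (u + τ i) ^ ε i‖ ≤ q := by
        refine (norm_sum_le _ _).trans ?_
        refine (Finset.sum_le_sum (g := fun _ => (1 : ℝ)) fun u _ => ?_).trans (by simp [q])
        rw [norm_prod]
        refine Finset.prod_le_one (fun _ _ => norm_nonneg _) fun i _ => ?_
        rw [norm_pow]
        exact pow_le_one₀ (norm_nonneg _) (χ.norm_apply_le_one _)
      have h2 : (0 : ℝ) ≤ (2 * r - 1 : ℕ) * √q := by positivity
      linarith
    · push Not at h
      obtain ⟨i, hi⟩ := h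
      have h1 := MulChar.norm_sum_prod_comp_le χ (τ := fun j => (τ j : F)) (hε1 i)
        (fun j hj h => hi j hj (Subtype.ext h))
      have hcard : Fintype.card (Fin (r + r)) = 2 * r := by rw [Fintype.card_fin, two_mul]
      rw [hcard] at h1
      rw [zero_add]
      exact h1
  rw [hnorm]
  refine (norm_sum_le _ _).trans ((Finset.sum_le_sum fun τ _ => hτ τ).trans (le_of_eq ?_))
  rw [Finset.sum_add_distrib, ← Finset.sum_filter, Finset.sum_const, Finset.sum_const, nsmul_eq_mul,
    nsmul_eq_mul, Finset.card_univ, Fintype.card_fun, Fintype.card_fin, Fintype.card_coe, two_mul,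
    noSingletonFiberCount, Nat.card_eq_fintype_card, Fintype.card_subtype]
  push_cast
  rfl

theorem MulChar.sum_erase_zero_norm_pow_add_le {F : Type*} [Field F] [Fintype F] [DecidableEq F]
    {χ : MulChar F ℂ} (hχ : χ ≠ 1) (J : Finset F) {r : ℕ} (hr : 0 < r) :
    ∑ u ∈ Finset.univ.erase 0, ‖∑ t ∈ J, χ (u + t)‖ ^ (2 * r) +
        √(Fintype.card F) * (#J : ℝ) ^ (2 * r) ≤
      (#J : ℝ) ^ (2 * r) * (2 * r) * √(Fintype.card F) +
        (2 * r * (#J : ℝ)) ^ r * Fintype.card F := by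
  set q := Fintype.card F with hq
  have hr1 : (1 : ℝ) ≤ r := by exact_mod_cast hr
  have hJ0 : (0 : ℝ) ≤ #J := by positivity
  rcases le_or_gt (2 * r) (#J) with hJ | hJ
  · have h1 : ∑ u ∈ Finset.univ.erase 0, ‖∑ t ∈ J, χ (u + t)‖ ^ (2 * r) ≤
        ∑ u, ‖∑ t ∈ J, χ (u + t)‖ ^ (2 * r) :=
      Finset.sum_le_sum_of_subset_of_nonneg (Finset.erase_subset _ _) fun _ _ _ => by positivity
    have h2 := MulChar.sum_norm_sum_pow_le hχ J r
    obtain ⟨m, rfl⟩ : ∃ m, r = m + 1 := ⟨r - 1, by omega⟩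
    have hcard : Nat.card J = #J := by simp
    have h3 := (noSingletonFiberCount_le J (by rw [hcard]; exact hJ) (le_refl (m + 1))).1
    rw [hcard, show 2 * m + 2 = 2 * (m + 1) by ring] at h3
    have h4 : (noSingletonFiberCount J (2 * (m + 1)) : ℝ) * q ≤
        (2 * (m + 1) * #J) ^ (m + 1) * q := by gcongr
    have h5 : ((2 * (m + 1) - 1 : ℕ) : ℝ) = 2 * (m + 1) - 1 := by
      rw [Nat.cast_sub (by omega)]
      push_cast
      ring
    rw [h5] at h2
    push_cast
    linarith
  · have h1 : ∑ u ∈ Finset.univ.erase (0 : F), ‖∑ t ∈ J, χ (u + t)‖ ^ (2 * r) ≤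
        q * (#J : ℝ) ^ (2 * r) := by
      refine (Finset.sum_le_sum_of_subset_of_nonneg (Finset.erase_subset _ _)
        fun _ _ _ => by positivity).trans ?_
      refine (Finset.sum_le_sum (g := fun _ => (#J : ℝ) ^ (2 * r)) fun u _ => ?_).trans (le_of_eq ?_)
      · refine pow_le_pow_left₀ (norm_nonneg _) ?_ _
        refine (norm_sum_le _ _).trans ((Finset.sum_le_sum fun t _ =>
          χ.norm_apply_le_one (u + t)).trans (by simp))
      · rw [Finset.sum_const, Finset.card_univ, nsmul_eq_mul]
    have hJ' : (#J : ℝ) ≤ 2 * r := by exact_mod_cast hJ.le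
    have h2 : (#J : ℝ) ^ (2 * r) ≤ (2 * r * (#J : ℝ)) ^ r := by
      rw [pow_mul]
      refine pow_le_pow_left₀ (by positivity) ?_ _
      nlinarith
    have h3 : (q : ℝ) * (#J : ℝ) ^ (2 * r) ≤ q * (2 * r * (#J : ℝ)) ^ r := by gcongr
    have h4 : (1 : ℝ) * (√q * (#J : ℝ) ^ (2 * r)) ≤ (2 * r) * (√q * (#J : ℝ) ^ (2 * r)) := by
      gcongr
      linarith
    linarith

theorem Finset.sum_card_filter_mul_card_filter {α β γ : Type*} [Fintype γ] [DecidableEq γ]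
    (s : Finset α) (t : Finset β) (f : α → γ) (g : β → γ) :
    ∑ u, #{x ∈ s | f x = u} * #{y ∈ t | g y = u} = #{z ∈ s ×ˢ t | f z.1 = g z.2} := by
  classical
  rw [Finset.card_eq_sum_card_fiberwise (f := fun z => f z.1) (t := Finset.univ)
    (fun _ _ => Finset.mem_coe.2 (Finset.mem_univ _))]
  refine Finset.sum_congr rfl fun u _ => ?_
  rw [← Finset.card_product, ← Finset.filter_product, Finset.filter_filter]
  congr 1
  ext z
  simp only [Finset.mem_filter]
  refine and_congr_right fun _ => ⟨fun h => ⟨h.1.trans h.2.symm, h.1⟩, fun h => ⟨h.2, h.1 ▸ h.2⟩⟩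

theorem Finset.mulEnergy_self_le_card_pow_four {M : Type*} [Mul M] [DecidableEq M]
    (S : Finset M) :
    Finset.mulEnergy S S ≤ #S ^ 4 := by
  refine (Finset.card_filter_le _ _).trans (le_of_eq ?_)
  simp only [Finset.card_product]
  ring

section Energy

variable {F : Type*} [Field F] [Fintype F] [DecidableEq F]

theorem Finset.sum_card_div_sq {S T : Finset F} (hT : 0 ∉ T) :
    ∑ u, #{z ∈ S ×ˢ T | z.1 / z.2 = u} ^ 2 = Finset.mulEnergy S T := by
  simp only [sq]
  rw [Finset.sum_card_filter_mul_card_filter, Finset.mulEnergy]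
  refine Finset.card_nbij' (fun w => ((w.1.1, w.2.1), (w.2.2, w.1.2)))
    (fun w => ((w.1.1, w.2.2), (w.1.2, w.2.1))) ?_ ?_ (fun _ _ => rfl) (fun _ _ => rfl)
  · rintro ⟨⟨x, y⟩, ⟨x', y'⟩⟩ h
    simp only [Finset.coe_filter, Set.mem_ofPred_eq, Finset.mem_product] at h ⊢
    obtain ⟨⟨⟨hx, hy⟩, hx', hy'⟩, h⟩ := h
    have h1 : y ≠ 0 := fun h0 => hT (h0 ▸ hy)
    have h2 : y' ≠ 0 := fun h0 => hT (h0 ▸ hy')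
    rw [div_eq_div_iff h1 h2] at h
    exact ⟨⟨⟨hx, hx'⟩, hy', hy⟩, h⟩
  · rintro ⟨⟨x, x'⟩, ⟨y', y⟩⟩ h
    simp only [Finset.coe_filter, Set.mem_ofPred_eq, Finset.mem_product] at h ⊢
    obtain ⟨⟨⟨hx, hx'⟩, hy', hy⟩, h⟩ := h
    have h1 : y ≠ 0 := fun h0 => hT (h0 ▸ hy)
    have h2 : y' ≠ 0 := fun h0 => hT (h0 ▸ hy')
    exact ⟨⟨⟨hx, hy⟩, hx', hy'⟩, (div_eq_div_iff h1 h2).2 h⟩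

theorem Finset.sum_card_div_mul_card_div {S T : Finset F} (hS : 0 ∉ S) (hT : 0 ∉ T) :
    ∑ u, #{z ∈ S ×ˢ S | z.1 / z.2 = u} * #{z ∈ T ×ˢ T | z.1 / z.2 = u} =
      Finset.mulEnergy S T := by
  rw [Finset.sum_card_filter_mul_card_filter, Finset.mulEnergy]
  refine Finset.card_nbij' (fun w => ((w.1.1, w.1.2), (w.2.2, w.2.1)))
    (fun w => ((w.1.1, w.1.2), (w.2.2, w.2.1))) ?_ ?_ (fun _ _ => rfl) (fun _ _ => rfl)
  · rintro ⟨⟨x, x'⟩, ⟨y, y'⟩⟩ h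
    simp only [Finset.coe_filter, Set.mem_ofPred_eq, Finset.mem_product] at h ⊢
    obtain ⟨⟨⟨hx, hx'⟩, hy, hy'⟩, h⟩ := h
    have h1 : x' ≠ 0 := fun h0 => hS (h0 ▸ hx')
    have h2 : y' ≠ 0 := fun h0 => hT (h0 ▸ hy')
    rw [div_eq_div_iff h1 h2] at h
    exact ⟨⟨⟨hx, hx'⟩, hy', hy⟩, by rw [h, mul_comm]⟩
  · rintro ⟨⟨x, x'⟩, ⟨y', y⟩⟩ h
    simp only [Finset.coe_filter, Set.mem_ofPred_eq, Finset.mem_product] at h ⊢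
    obtain ⟨⟨⟨hx, hx'⟩, hy', hy⟩, h⟩ := h
    have h1 : x' ≠ 0 := fun h0 => hS (h0 ▸ hx')
    have h2 : y' ≠ 0 := fun h0 => hT (h0 ▸ hy')
    exact ⟨⟨⟨hx, hx'⟩, hy, hy'⟩, (div_eq_div_iff h1 h2).2 (by rw [h, mul_comm])⟩

theorem Finset.mulEnergy_sq_le {S T : Finset F} (hS : 0 ∉ S) (hT : 0 ∉ T) :
    Finset.mulEnergy S T ^ 2 ≤ Finset.mulEnergy S S * Finset.mulEnergy T T := by
  rw [← Finset.sum_card_div_mul_card_div hS hT, ← Finset.sum_card_div_sq hS,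
    ← Finset.sum_card_div_sq hT]
  exact Finset.sum_mul_sq_le_sq_mul_sq _ _ _

theorem Finset.mulEnergy_erase_zero_add_le {S : Finset F} (hS : 0 ∈ S) :
    Finset.mulEnergy (S.erase 0) (S.erase 0) + (2 * #(S.erase 0) + 1) ^ 2 ≤
      Finset.mulEnergy S S := by
  rw [Finset.mulEnergy_eq_sum_sq, Finset.mulEnergy_eq_sum_sq,
    ← Finset.add_sum_erase Finset.univ _ (Finset.mem_univ 0),
    ← Finset.add_sum_erase Finset.univ (fun a => #{z ∈ S ×ˢ S | z.1 * z.2 = a} ^ 2)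
      (Finset.mem_univ 0)]
  have h1 : #{z ∈ S.erase 0 ×ˢ S.erase 0 | z.1 * z.2 = 0} = 0 := by
    rw [Finset.card_eq_zero, Finset.filter_eq_empty_iff]
    intro z hz
    simp only [Finset.mem_product, Finset.mem_erase] at hz
    exact mul_ne_zero hz.1.1 hz.2.1
  have h2 : 2 * #(S.erase 0) + 1 ≤ #{z ∈ S ×ˢ S | z.1 * z.2 = 0} := by
    have h3 := Finset.card_filter_add_card_filter_not (s := S ×ˢ S) (fun z => z.1 * z.2 = 0)
    have h4 : #{z ∈ S ×ˢ S | ¬ z.1 * z.2 = 0} ≤ #(S.erase 0 ×ˢ S.erase 0) := by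
      refine Finset.card_le_card fun z hz => ?_
      simp only [Finset.mem_filter, Finset.mem_product, mul_eq_zero, not_or] at hz
      simp only [Finset.mem_product, Finset.mem_erase]
      exact ⟨⟨hz.2.1, hz.1.1⟩, hz.2.2, hz.1.2⟩
    rw [Finset.card_product] at h3 h4
    have h5 := Finset.card_erase_add_one hS
    rw [← h5] at h3
    nlinarith
  have h6 : ∑ a ∈ Finset.univ.erase 0, #{z ∈ S.erase 0 ×ˢ S.erase 0 | z.1 * z.2 = a} ^ 2 ≤
      ∑ a ∈ Finset.univ.erase 0, #{z ∈ S ×ˢ S | z.1 * z.2 = a} ^ 2 := by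
    gcongr <;> exact Finset.erase_subset _ _
  have h7 := Nat.pow_le_pow_left h2 2
  rw [h1]
  omega

open scoped Pointwise in
theorem Finset.card_pow_four_le_mul_mulEnergy (S : Finset F) :
    #S ^ 4 ≤ Fintype.card F * Finset.mulEnergy S S := by
  calc #S ^ 4 = #S ^ 2 * #S ^ 2 := by ring
    _ ≤ #(S * S) * Finset.mulEnergy S S := Finset.le_card_mul_mul_mulEnergy S S
    _ ≤ _ := Nat.mul_le_mul_right _ (Finset.card_le_univ _)

theorem Finset.sum_card_dilate_sq_le {A B : Finset F} (hB : 0 ∉ B) :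
    (#{z ∈ A ×ˢ B | z.1 = 0 * z.2} : ℝ) ^ 2 / √(Fintype.card F) +
        ∑ u ∈ Finset.univ.erase 0, (#{z ∈ A ×ˢ B | z.1 = u * z.2} : ℝ) ^ 2 ≤
      √((Finset.mulEnergy A A : ℝ) * Finset.mulEnergy B B) := by
  have h1 : ∑ u ∈ Finset.univ.erase 0, (#{z ∈ A ×ˢ B | z.1 = u * z.2} : ℝ) ^ 2 ≤
      Finset.mulEnergy (A.erase 0) B := by
    rw [← Finset.sum_card_div_sq hB]
    push_cast
    refine (Finset.sum_le_sum fun u hu => ?_).trans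
      (Finset.sum_le_sum_of_subset_of_nonneg (Finset.erase_subset 0 _) fun _ _ _ => by positivity)
    gcongr
    intro z hz
    simp only [Finset.mem_filter, Finset.mem_product, Finset.mem_erase] at hz hu ⊢
    have hz2 : z.2 ≠ 0 := fun h => hB (h ▸ hz.1.2)
    exact ⟨⟨⟨hz.2 ▸ mul_ne_zero hu.1 hz2, hz.1.1⟩, hz.1.2⟩, (div_eq_iff hz2).2 hz.2⟩
  set X : ℝ := (Finset.mulEnergy (A.erase 0) (A.erase 0) : ℝ) with hX
  set Y : ℝ := (Finset.mulEnergy B B : ℝ) with hY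
  have hX0 : 0 ≤ X := by positivity
  have hY0 : 0 ≤ Y := by positivity
  have h2 : (Finset.mulEnergy (A.erase 0) B : ℝ) ≤ √X * √Y := by
    rw [← Real.sqrt_mul hX0]
    refine Real.le_sqrt_of_sq_le ?_
    rw [hX, hY]
    exact_mod_cast Finset.mulEnergy_sq_le (Finset.notMem_erase 0 A) hB
  have hEA0 : (0 : ℝ) ≤ (Finset.mulEnergy A A : ℝ) := by positivity
  rw [Real.sqrt_mul hEA0]
  by_cases hA : 0 ∈ A
  · have h3 : 1 + √X ≤ √(Finset.mulEnergy A A : ℝ) := by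
      refine Real.le_sqrt_of_sq_le ?_
      have h4 : √X ≤ (#(A.erase 0) : ℝ) ^ 2 := by
        refine Real.sqrt_le_iff.2 ⟨by positivity, ?_⟩
        rw [← pow_mul, hX]
        exact_mod_cast Finset.mulEnergy_self_le_card_pow_four (A.erase 0)
      have h5 : X + (2 * #(A.erase 0) + 1) ^ 2 ≤ (Finset.mulEnergy A A : ℝ) := by
        rw [hX]
        exact_mod_cast Finset.mulEnergy_erase_zero_add_le hA
      have h6 := Real.sq_sqrt hX0
      have h7 : (0 : ℝ) ≤ #(A.erase 0) := by positivity
      nlinarith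
    have h8 : (#{z ∈ A ×ˢ B | z.1 = 0 * z.2} : ℝ) ≤ #B := by
      have : #{z ∈ A ×ˢ B | z.1 = 0 * z.2} ≤ #(({0} : Finset F) ×ˢ B) := by
        refine Finset.card_le_card fun z hz => ?_
        simp only [Finset.mem_filter, Finset.mem_product, zero_mul] at hz
        exact Finset.mem_product.2 ⟨Finset.mem_singleton.2 hz.2, hz.1.2⟩
      rw [Finset.card_product, Finset.card_singleton, one_mul] at this
      exact_mod_cast this
    have hq : (0 : ℝ) < Fintype.card F := by exact_mod_cast Fintype.card_pos
    have h9 : (#B : ℝ) ^ 2 ≤ √Y * √(Fintype.card F) := by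
      rw [← Real.sqrt_mul hY0]
      refine Real.le_sqrt_of_sq_le ?_
      rw [← pow_mul, hY, mul_comm (Finset.mulEnergy B B : ℝ)]
      exact_mod_cast Finset.card_pow_four_le_mul_mulEnergy B
    have h10 : (#{z ∈ A ×ˢ B | z.1 = 0 * z.2} : ℝ) ^ 2 / √(Fintype.card F) ≤ √Y := by
      rw [div_le_iff₀ (Real.sqrt_pos.2 hq)]
      exact (pow_le_pow_left₀ (by positivity) h8 2).trans h9
    have h11 : (1 + √X) * √Y ≤ √(Finset.mulEnergy A A : ℝ) * √Y := by gcongr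
    linarith
  · have h3 : #{z ∈ A ×ˢ B | z.1 = 0 * z.2} = 0 := by
      rw [Finset.card_eq_zero, Finset.filter_eq_empty_iff]
      intro z hz h
      rw [zero_mul] at h
      exact hA (h ▸ (Finset.mem_product.1 hz).1)
    rw [h3, ← Finset.erase_eq_of_notMem hA]
    simp only [Nat.cast_zero, ne_eq, OfNat.ofNat_ne_zero, not_false_eq_true, zero_pow, zero_div,
      zero_add]
    rw [Finset.erase_eq_of_notMem hA] at hX h1 h2
    rw [Finset.erase_eq_of_notMem hA, ← hX]
    exact h1.trans h2

end Energy

theorem Real.sum_mul_pow_two_mul_le {ι : Type*} (s : Finset ι) (f g w : ι → ℝ)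
    (hf : ∀ i ∈ s, 0 ≤ f i) (hg : ∀ i ∈ s, 0 ≤ g i) (hw : ∀ i ∈ s, 0 < w i) (r : ℕ) :
    (∑ i ∈ s, f i * g i) ^ (2 * (r + 1)) ≤
      (∑ i ∈ s, f i) ^ (2 * r) * (∑ i ∈ s, f i ^ 2 * w i) *
        ∑ i ∈ s, (w i)⁻¹ * g i ^ (2 * (r + 1)) := by
  have hF : 0 ≤ ∑ i ∈ s, f i := Finset.sum_nonneg hf
  have h1 : (∑ i ∈ s, f i * g i) ^ (r + 1) ≤
      (∑ i ∈ s, f i) ^ r * ∑ i ∈ s, f i * g i ^ (r + 1) := by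
    rcases hF.eq_or_lt with h0 | h0
    · have h2 : ∀ i ∈ s, f i = 0 := (Finset.sum_eq_zero_iff_of_nonneg hf).1 h0.symm
      have h3 : ∀ h : ι → ℝ, ∑ i ∈ s, f i * h i = 0 := fun h =>
        Finset.sum_eq_zero fun i hi => by rw [h2 i hi, zero_mul]
      rw [h3 g, h3]
      simp
    · have h2 := Real.pow_arith_mean_le_arith_mean_pow s (fun i => f i / ∑ j ∈ s, f j) g
        (fun i hi => div_nonneg (hf i hi) hF) (by rw [← Finset.sum_div, div_self h0.ne']) hg (r + 1)
      simp only [div_mul_eq_mul_div] at h2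
      rw [← Finset.sum_div, ← Finset.sum_div, div_pow, div_le_div_iff₀ (by positivity) h0] at h2
      rw [← mul_le_mul_iff_left₀ h0]
      calc _ ≤ _ := h2
        _ = _ := by ring
  have h2 : (∑ i ∈ s, f i * g i ^ (r + 1)) ^ 2 ≤
      (∑ i ∈ s, f i ^ 2 * w i) * ∑ i ∈ s, (w i)⁻¹ * g i ^ (2 * (r + 1)) := by
    have h3 := Finset.sum_mul_sq_le_sq_mul_sq s (fun i => f i * √(w i))
      (fun i => (√(w i))⁻¹ * g i ^ (r + 1))
    refine le_of_eq_of_le ?_ (h3.trans (le_of_eq ?_))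
    · congr 1
      refine Finset.sum_congr rfl fun i hi => ?_
      have := Real.sqrt_pos.2 (hw i hi)
      field_simp
    · congr 1
      · refine Finset.sum_congr rfl fun i hi => ?_
        rw [mul_pow, Real.sq_sqrt (hw i hi).le]
      · refine Finset.sum_congr rfl fun i hi => ?_
        rw [mul_pow, inv_pow, Real.sq_sqrt (hw i hi).le, ← pow_mul, mul_comm 2]
  have h4 : 0 ≤ ∑ i ∈ s, f i * g i := Finset.sum_nonneg fun i hi => mul_nonneg (hf i hi) (hg i hi)
  calc (∑ i ∈ s, f i * g i) ^ (2 * (r + 1)) = ((∑ i ∈ s, f i * g i) ^ (r + 1)) ^ 2 := by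
        rw [← pow_mul, mul_comm]
    _ ≤ ((∑ i ∈ s, f i) ^ r * ∑ i ∈ s, f i * g i ^ (r + 1)) ^ 2 :=
        pow_le_pow_left₀ (by positivity) h1 2
    _ = (∑ i ∈ s, f i) ^ (2 * r) * (∑ i ∈ s, f i * g i ^ (r + 1)) ^ 2 := by ring
    _ ≤ (∑ i ∈ s, f i) ^ (2 * r) * ((∑ i ∈ s, f i ^ 2 * w i) *
        ∑ i ∈ s, (w i)⁻¹ * g i ^ (2 * (r + 1))) := by gcongr
    _ = _ := by ring

theorem MulChar.sum_card_dilate_mul_norm_pow_le {F : Type*} [Field F] [Fintype F] [DecidableEq F]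
    {χ : MulChar F ℂ} (hχ : χ ≠ 1) {A B : Finset F} (J : Finset F) (hB : 0 ∉ B) (r : ℕ) :
    (∑ u, (#{z ∈ A ×ˢ B | z.1 = u * z.2} : ℝ) * ‖∑ t ∈ J, χ (u + t)‖) ^ (2 * (r + 1)) ≤
      ((#A : ℝ) * #B) ^ (2 * r) * √((Finset.mulEnergy A A : ℝ) * Finset.mulEnergy B B) *
        ((#J : ℝ) ^ (2 * (r + 1)) * (2 * (r + 1)) * √(Fintype.card F) +
          (2 * (r + 1) * (#J : ℝ)) ^ (r + 1) * Fintype.card F) := by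
  have hq : (0 : ℝ) < √(Fintype.card F) :=
    Real.sqrt_pos.2 (by exact_mod_cast Fintype.card_pos)
  set w : F → ℝ := fun u => if u = 0 then (√(Fintype.card F))⁻¹ else 1 with hw
  have hw0 : ∀ u, 0 < w u := fun u => by
    simp only [hw]
    split_ifs <;> positivity
  have h1 := Real.sum_mul_pow_two_mul_le Finset.univ
    (fun u => (#{z ∈ A ×ˢ B | z.1 = u * z.2} : ℝ)) (fun u => ‖∑ t ∈ J, χ (u + t)‖) w
    (fun _ _ => by positivity) (fun _ _ => by positivity) (fun u _ => hw0 u) r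
  have h2 : ∑ u, (#{z ∈ A ×ˢ B | z.1 = u * z.2} : ℝ) = #A * #B := by
    rw [← Nat.cast_sum, ← Nat.cast_mul, ← Finset.card_product,
      Finset.card_eq_sum_card_fiberwise (f := fun z : F × F => z.1 / z.2) (t := Finset.univ)
        (fun _ _ => Finset.mem_coe.2 (Finset.mem_univ _))]
    congr 1
    refine Finset.sum_congr rfl fun u _ => congrArg _ (Finset.filter_congr fun z hz => ?_)
    rw [div_eq_iff fun h => hB (h ▸ (Finset.mem_product.1 hz).2)]
  have h3 : ∑ u, (#{z ∈ A ×ˢ B | z.1 = u * z.2} : ℝ) ^ 2 * w u ≤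
      √((Finset.mulEnergy A A : ℝ) * Finset.mulEnergy B B) := by
    refine le_of_eq_of_le ?_ (Finset.sum_card_dilate_sq_le (A := A) hB)
    rw [← Finset.add_sum_erase Finset.univ _ (Finset.mem_univ 0)]
    congr 1
    · simp only [hw, if_true, div_eq_mul_inv]
    · refine Finset.sum_congr rfl fun u hu => ?_
      simp only [hw, if_neg (Finset.mem_erase.1 hu).1, mul_one]
  have h4 : ∑ u, (w u)⁻¹ * ‖∑ t ∈ J, χ (u + t)‖ ^ (2 * (r + 1)) ≤
      (#J : ℝ) ^ (2 * (r + 1)) * (2 * (r + 1)) * √(Fintype.card F) +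
        (2 * (r + 1) * (#J : ℝ)) ^ (r + 1) * Fintype.card F := by
    have h5 := MulChar.sum_erase_zero_norm_pow_add_le hχ J (Nat.succ_pos r)
    push_cast at h5
    refine le_trans ?_ h5
    rw [← Finset.add_sum_erase Finset.univ _ (Finset.mem_univ 0), add_comm]
    refine add_le_add (le_of_eq ?_) ?_
    · refine Finset.sum_congr rfl fun u hu => ?_
      simp only [hw, if_neg (Finset.mem_erase.1 hu).1, inv_one, one_mul]
    · simp only [hw, if_true, inv_inv]
      gcongr
      exact (norm_sum_le _ _).trans ((Finset.sum_le_sum fun t _ =>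
          χ.norm_apply_le_one (0 + t)).trans (by simp))
  rw [h2] at h1
  refine h1.trans ?_
  have h6 : 0 ≤ ∑ u, (w u)⁻¹ * ‖∑ t ∈ J, χ (u + t)‖ ^ (2 * (r + 1)) :=
    Finset.sum_nonneg fun u _ => mul_nonneg (inv_nonneg.2 (hw0 u).le) (by positivity)
  gcongr

theorem multEnergy_eq_mulEnergy {p : ℕ} (S : Finset (ZMod p)) :
    multEnergy S = Finset.mulEnergy S S := by
  rw [multEnergy, Finset.mulEnergy]
  exact Finset.card_nbij' (fun w => ((w.1.1, w.2.1), (w.1.2, w.2.2)))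
    (fun w => ((w.1.1, w.2.1), (w.1.2, w.2.2)))
    (fun w h => by
      simp only [Finset.coe_filter, Set.mem_ofPred_eq, Finset.mem_product] at h ⊢
      tauto)
    (fun w h => by
      simp only [Finset.coe_filter, Set.mem_ofPred_eq, Finset.mem_product] at h ⊢
      tauto)
    (fun _ _ => rfl) (fun _ _ => rfl)

end

/-- **Burgess' amplification lemma in terms of multiplicative energy.**
Let p be prime, χ a nontrivial Dirichlet character mod p, and A, B, J ⊆ F_p with
0 ∉ B. With ν(u) = #{(x, y) ∈ A × B : x = u·y}, for every positive integer r: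
∑_u ν(u)·|∑_{t∈J} χ(u+t)| ≤ (|A||B|)^(1−1/r) · (E_×(A)E_×(B))^(1/(4r)) ·
(|J|^(2r)·2r·√p + (2r|J|)^r·p)^(1/(2r)). -/
theorem stmt4 (p : ℕ) (hp : p.Prime) [NeZero p]
    (χ : DirichletCharacter ℂ p) (hχ : χ ≠ 1)
    (A B J : Finset (ZMod p)) (hB : (0 : ZMod p) ∉ B)
    (ν : ZMod p → ℕ)
    (hν : ∀ u, ν u = ((A ×ˢ B).filter (fun q => q.1 = u * q.2)).card)
    (r : ℕ) (hr : 0 < r) :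
    ∑ u : ZMod p, (ν u : ℝ) * ‖∑ t ∈ J, χ (u + t)‖ ≤
      ((A.card : ℝ) * B.card) ^ (1 - 1 / (r : ℝ)) *
        ((multEnergy A : ℝ) * multEnergy B) ^ (1 / (4 * (r : ℝ))) *
        ((J.card : ℝ) ^ (2 * r) * (2 * r) * Real.sqrt p +
          (2 * r * (J.card : ℝ)) ^ r * p) ^ (1 / (2 * (r : ℝ))) := by
  have : Fact p.Prime := ⟨hp⟩
  obtain ⟨m, rfl⟩ : ∃ m, r = m + 1 := ⟨r - 1, by omega⟩
  have h1 := MulChar.sum_card_dilate_mul_norm_pow_le hχ (A := A) J hB m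
  simp only [← hν, ← multEnergy_eq_mulEnergy, ZMod.card] at h1
  set E : ℝ := (multEnergy A : ℝ) * multEnergy B with hE
  set W : ℝ := (#J : ℝ) ^ (2 * (m + 1)) * (2 * (m + 1)) * √p +
    (2 * (m + 1) * (#J : ℝ)) ^ (m + 1) * p with hW
  set N : ℝ := (#A : ℝ) * #B with hN
  have hE0 : 0 ≤ E := by positivity
  have hW0 : 0 ≤ W := by positivity
  have hN0 : 0 ≤ N := by positivity
  push_cast
  rw [← hW]
  have hm : (0 : ℝ) < m + 1 := by positivity
  refine le_of_pow_le_pow_left₀ (n := 2 * (m + 1)) (by omega) (by positivity) (h1.trans (le_of_eq ?_))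
  simp only [mul_pow, ← Real.rpow_natCast, ← Real.rpow_mul hE0, ← Real.rpow_mul hW0,
    ← Real.rpow_mul hN0, Real.sqrt_eq_rpow]
  have h2 : (1 - 1 / ((m + 1 : ℕ) : ℝ)) * (2 * (m + 1)) = 2 * m := by
    push_cast
    field_simp
    ring
  have h3 : 1 / (4 * ((m : ℝ) + 1)) * (2 * (m + 1)) = 1 / 2 := by
    field_simp
    norm_num
  push_cast at h2 ⊢
  rw [h2, h3, one_div_mul_cancel (by positivity), Real.rpow_one]
end

section
/- There is an absolute constant C > 0 such that for every prime p and every nonempty subset B ⊆ F_p, E_×(B) ≤ C · (E_×(B − B) + |B|²), where B − B = {b₁ − b₂ : b₁, b₂ ∈ B}. -/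
open Finset Pointwise

/-- The nonzero elements `x` of `S` such that `l * x` is again in `S`. -/
def dilateFiber {p : ℕ} (S : Finset (ZMod p)) (l : ZMod p) : Finset (ZMod p) :=
  S.filter (fun x => x ≠ 0 ∧ l * x ∈ S)

section
variable {p : ℕ} [Fact p.Prime]

theorem sum_sq_card_dilateFiber_le (S : Finset (ZMod p)) :
    ∑ l ∈ univ.erase (0 : ZMod p), (dilateFiber S l).card ^ 2 ≤ multEnergy S := by
  have h : ∑ l ∈ univ.erase (0 : ZMod p), (dilateFiber S l).card ^ 2 =
      ((univ.erase (0 : ZMod p)).sigma fun l => dilateFiber S l ×ˢ dilateFiber S l).card := by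
    simp [card_sigma, sq]
  rw [h, multEnergy]
  refine card_le_card_of_injOn (fun t => ((t.2.1, t.1 * t.2.2), (t.1 * t.2.1, t.2.2))) ?_ ?_
  · rintro ⟨l, x, y⟩ ht
    simp [dilateFiber] at ht ⊢
    refine ⟨⟨?_, ?_⟩, by ring⟩ <;> tauto
  · rintro ⟨l, x, y⟩ ht ⟨l', x', y'⟩ ht' heq
    simp [dilateFiber] at ht ht' heq
    obtain ⟨⟨rfl, -⟩, h2, rfl⟩ := heq
    have : l = l' := mul_right_cancel₀ ht.2.1.2.1 h2
    subst this
    rfl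

theorem card_mul_eq_zero_le (S : Finset (ZMod p)) :
    ((S ×ˢ S).filter fun q => q.1 * q.2 = 0).card ≤ 2 * S.card := by
  calc ((S ×ˢ S).filter fun q => q.1 * q.2 = 0).card
      ≤ (({0} ×ˢ S) ∪ (S ×ˢ {0})).card := by
        refine card_le_card ?_
        rintro ⟨x, y⟩ h
        simp at h ⊢
        tauto
    _ ≤ _ := by
        refine (card_union_le _ _).trans ?_
        simp [two_mul]

theorem multEnergy_le_sum (S : Finset (ZMod p)) :
    multEnergy S ≤ 4 * S.card ^ 2 +
      ∑ l ∈ univ.erase (0 : ZMod p), (dilateFiber S l).card ^ 2 := by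
  have h : ∑ l ∈ univ.erase (0 : ZMod p), (dilateFiber S l).card ^ 2 =
      ((univ.erase (0 : ZMod p)).sigma fun l => dilateFiber S l ×ˢ dilateFiber S l).card := by
    simp [card_sigma, sq]
  rw [h, multEnergy, ← card_filter_add_card_filter_not (fun q => q.1.1 * q.1.2 = 0)]
  refine add_le_add ?_ ?_
  · refine (card_le_card (t := ((S ×ˢ S).filter fun q => q.1 * q.2 = 0) ×ˢ
      ((S ×ˢ S).filter fun q => q.1 * q.2 = 0)) ?_).trans ?_
    · rintro ⟨⟨a, b⟩, c, d⟩ hq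
      simp only [mem_filter, mem_product] at hq ⊢
      obtain ⟨⟨⟨h1, h2⟩, h3⟩, h4⟩ := hq
      exact ⟨⟨h1, h4⟩, h2, h3 ▸ h4⟩
    · rw [card_product]
      nlinarith [Nat.mul_le_mul (card_mul_eq_zero_le S) (card_mul_eq_zero_le S)]
  · refine card_le_card_of_injOn (fun q => ⟨q.2.1 / q.1.1, q.1.1, q.2.2⟩) ?_ ?_
    · rintro ⟨⟨a, b⟩, c, d⟩ hq
      simp only [coe_filter, mem_filter, mem_product, Set.mem_ofPred_eq] at hq
      obtain ⟨⟨⟨⟨ha, hb⟩, hc, hd⟩, he⟩, hne⟩ := hq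
      have ha0 := left_ne_zero_of_mul hne
      have hc0 := left_ne_zero_of_mul (he ▸ hne)
      have hd0 := right_ne_zero_of_mul (he ▸ hne)
      have hca : c / a * a = c := by field_simp
      have hcd : c / a * d = b := by field_simp; exact he.symm
      simp [dilateFiber, *]
    · rintro ⟨⟨a, b⟩, c, d⟩ hq ⟨⟨a', b'⟩, c', d'⟩ hq' heq
      simp only [coe_filter, mem_filter, mem_product, Set.mem_ofPred_eq] at hq hq'
      simp only [Sigma.mk.injEq, heq_eq_eq, Prod.mk.injEq] at heq
      obtain ⟨h1, rfl, rfl⟩ := heq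
      have ha0 := left_ne_zero_of_mul hq.2
      have hc : c = c' := (div_left_inj' ha0).1 h1
      subst hc
      have hb : b = b' := mul_left_cancel₀ ha0 (hq.1.2.trans hq'.1.2.symm)
      rw [hb]

theorem sum_card_dilateFiber_le (S : Finset (ZMod p)) :
    ∑ l ∈ univ.erase (0 : ZMod p), (dilateFiber S l).card ≤ S.card ^ 2 := by
  rw [← card_sigma, sq, ← card_product]
  refine card_le_card_of_injOn (fun t => (t.2, t.1 * t.2)) ?_ ?_
  · rintro ⟨l, x⟩ ht
    simp [dilateFiber] at ht ⊢
    tauto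
  · rintro ⟨l, x⟩ ht ⟨l', x'⟩ ht' heq
    simp [dilateFiber] at ht ht' heq
    obtain ⟨rfl, h2⟩ := heq
    have : l = l' := mul_right_cancel₀ ht.2.2.1 h2
    subst this
    rfl

theorem card_dilateFiber_le_sub (S : Finset (ZMod p)) (l : ZMod p) :
    (dilateFiber S l).card ≤ (dilateFiber (S - S) l).card + 1 := by
  obtain h | ⟨x₀, h₀⟩ := (dilateFiber S l).eq_empty_or_nonempty
  · simp [h]
  rw [← Nat.sub_le_iff_le_add, ← card_erase_of_mem h₀]
  refine card_le_card_of_injOn (fun x => x - x₀) ?_ (sub_left_injective.injOn)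
  intro x hx
  simp only [dilateFiber, coe_erase, coe_filter, mem_filter, Set.mem_sdiff, Set.mem_ofPred_eq,
    Set.mem_singleton_iff] at hx h₀ ⊢
  exact ⟨sub_mem_sub hx.1.1 h₀.1, sub_ne_zero.2 hx.2,
    mul_sub l x x₀ ▸ sub_mem_sub hx.1.2.2 h₀.2.2⟩

theorem multEnergy_le_multEnergy_sub (S : Finset (ZMod p)) :
    multEnergy S ≤ 4 * multEnergy (S - S) + 5 * S.card ^ 2 := by
  have h : ∑ l ∈ univ.erase (0 : ZMod p), (dilateFiber S l).card ^ 2 ≤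
      ∑ l ∈ univ.erase (0 : ZMod p),
        (4 * (dilateFiber (S - S) l).card ^ 2 + (dilateFiber S l).card) := by
    refine sum_le_sum fun l _ => ?_
    have := card_dilateFiber_le_sub S l
    generalize (dilateFiber S l).card = m at *
    generalize (dilateFiber (S - S) l).card = n at *
    obtain _ | _ | m := m
    · simp
    · simp
    · nlinarith
  rw [sum_add_distrib, ← mul_sum] at h
  linarith [multEnergy_le_sum S, sum_card_dilateFiber_le S, sum_sq_card_dilateFiber_le (S - S)]

end

/-- There is an absolute constant C > 0 such that for every prime p and every
nonempty B ⊆ F_p, E_×(B) ≤ C · (E_×(B − B) + |B|²). -/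
theorem stmt6 :
    ∃ C : ℝ, 0 < C ∧
      ∀ (p : ℕ), p.Prime →
      ∀ (B : Finset (ZMod p)), B.Nonempty →
        (multEnergy B : ℝ) ≤ C * ((multEnergy (B - B) : ℝ) + (B.card : ℝ) ^ 2) := by
  refine ⟨5, by norm_num, fun p hp B _ => ?_⟩
  have : Fact p.Prime := ⟨hp⟩
  have h : (multEnergy B : ℝ) ≤ 4 * multEnergy (B - B) + 5 * (B.card : ℝ) ^ 2 := by
    exact_mod_cast multEnergy_le_multEnergy_sub B
  have : (0 : ℝ) ≤ multEnergy (B - B) := Nat.cast_nonneg _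
  linarith
end

section
/- Let p be a prime and let a₁, a₂, z be integers with a₁ ≢ 0 (mod p) and a₂ ≢ 0 (mod p). Define the lattice Γ_z = {(x₁, x₂, y₁, y₂) ∈ ℤ⁴ : z(a₁x₁ + a₂x₂) ≡ a₁y₁ + a₂y₂ (mod p)}. Then {v ∈ ℝ⁴ : ⟨v, w⟩ ∈ ℤ for all w ∈ Γ_z} = ℤ⁴ + {p^{−1}(za₁t, za₂t, −a₁t, −a₂t) : t ∈ ℤ}, where ⟨·,·⟩ is the standard inner product on ℝ⁴. -/
open Finset

/-- The lattice Γ_z = {(x₁,x₂,y₁,y₂) ∈ ℤ⁴ : z(a₁x₁+a₂x₂) ≡ a₁y₁+a₂y₂ (mod p)},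
viewed as a subset of ℝ⁴. -/
def GammaZ (p : ℕ) (a₁ a₂ z : ℤ) : Set (Fin 4 → ℝ) :=
  {v | ∃ m : Fin 4 → ℤ, (∀ i, v i = (m i : ℝ)) ∧
    z * (a₁ * m 0 + a₂ * m 1) ≡ a₁ * m 2 + a₂ * m 3 [ZMOD (p : ℤ)]}

/-- **Description of the dual lattice of Γ_z.**
The dual lattice {v ∈ ℝ⁴ : ⟨v,w⟩ ∈ ℤ for all w ∈ Γ_z} equals
ℤ⁴ + {p⁻¹(za₁t, za₂t, −a₁t, −a₂t) : t ∈ ℤ}. -/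
theorem stmt7 (p : ℕ) (hp : p.Prime) (a₁ a₂ z : ℤ)
    (ha₁ : ¬ (p : ℤ) ∣ a₁) (ha₂ : ¬ (p : ℤ) ∣ a₂) :
    {v : Fin 4 → ℝ | ∀ w ∈ GammaZ p a₁ a₂ z, ∃ k : ℤ, (∑ i, v i * w i) = (k : ℝ)} =
      {v : Fin 4 → ℝ | ∃ (n : Fin 4 → ℤ) (t : ℤ),
        v = fun i => (n i : ℝ) + (p : ℝ)⁻¹ * (((![z * a₁, z * a₂, -a₁, -a₂] : Fin 4 → ℤ) i : ℝ) * (t : ℝ))} := by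
  have hp0 : (p : ℝ) ≠ 0 := by exact_mod_cast hp.ne_zero
  ext v
  simp only [Set.mem_ofPred_eq]
  constructor
  · intro h
    have pairing (m : Fin 4 → ℤ)
        (hm : (p : ℤ) ∣ (a₁ * m 2 + a₂ * m 3) - z * (a₁ * m 0 + a₂ * m 1)) :
        ∃ k : ℤ, v 0 * m 0 + v 1 * m 1 + v 2 * m 2 + v 3 * m 3 = (k : ℝ) := by
      simpa [Fin.sum_univ_four] using
        h (fun i => (m i : ℝ)) ⟨m, fun _ => rfl, Int.modEq_iff_dvd.mpr hm⟩
    obtain ⟨c, b, hbc⟩ : IsCoprime (p : ℤ) a₁ :=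
      (Nat.prime_iff_prime_int.mp hp).coprime_iff_not_dvd.mpr ha₁
    obtain ⟨K, hK⟩ := pairing ![0, 0, p, 0] ⟨a₁, by simp; ring⟩
    obtain ⟨L, hL⟩ := pairing ![0, 0, -(b * a₂), 1]
      ⟨c * a₂, by simp; linear_combination -a₂ * hbc⟩
    obtain ⟨M, hM⟩ := pairing ![1, 0, z, 0] ⟨0, by simp; ring⟩
    obtain ⟨N, hN⟩ := pairing ![0, 1, z * b * a₂, 0]
      ⟨-(c * a₂ * z), by simp; linear_combination a₂ * z * hbc⟩
    have hbc' : (c : ℝ) * p + b * a₁ = 1 := by exact_mod_cast hbc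
    simp at hK hL hM hN
    refine ⟨![M - z * (c * K), N, c * K, L], -(b * K), ?_⟩
    have h2 : v 2 = K / p := by field_simp; exact hK
    rw [h2] at hL hM hN
    funext i
    fin_cases i
    · simp
      field_simp at hM ⊢
      linear_combination hM + z * K * hbc'
    · simp
      field_simp at hN ⊢
      linear_combination hN
    · simp [h2]
      field_simp
      linear_combination -K * hbc'
    · simp
      field_simp at hL ⊢
      linear_combination hL
  · rintro ⟨n, t, rfl⟩ w ⟨m, hw, hm⟩
    obtain ⟨d, hd⟩ := Int.modEq_iff_dvd.mp hm
    have hd' : (a₁ * m 2 + a₂ * m 3 : ℝ) - z * (a₁ * m 0 + a₂ * m 1) = p * d := by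
      exact_mod_cast hd
    refine ⟨n 0 * m 0 + n 1 * m 1 + n 2 * m 2 + n 3 * m 3 - t * d, ?_⟩
    simp [Fin.sum_univ_four, hw]
    field_simp
    linear_combination -t * hd'
end

section
/- Let p be prime, let a₁, a₂ ∈ F_p with a₂ ≠ 0, let z ∈ F_p, let H₁, H₂ be positive integers, and let λ > 0 satisfy λH₁ < 1. Suppose v = (x₁, x₂, y₁, y₂) and v' = (x₁', x₂', y₁', y₂') are ℝ-linearly independent vectors in ℤ⁴ with |x₁|, |y₁|, |x₁'|, |y₁'| ≤ λH₁ and |x₂|, |y₂|, |x₂'|, |y₂'| ≤ λH₂, such that z·(a₁x₁ + a₂x₂) = a₁y₁ + a₂y₂ and z·(a₁x₁' + a₂x₂') = a₁y₁' + a₂y₂' in F_p. Then 2λ²H₂² ≥ p. -/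
open Finset

lemma Int.eq_zero_of_abs_cast_le_of_lt_one {n : ℤ} {c : ℝ} (h : |(n : ℝ)| ≤ c) (hc : c < 1) :
    n = 0 :=
  Int.abs_lt_one_iff.mp (by exact_mod_cast h.trans_lt hc)

lemma det_ne_zero_of_linearIndependent_of_support {v v' : Fin 4 → ℤ}
    (hind : LinearIndependent ℝ ![fun i => (v i : ℝ), fun i => (v' i : ℝ)])
    (h0 : v 0 = 0) (h2 : v 2 = 0) (h0' : v' 0 = 0) (h2' : v' 2 = 0) :
    v 1 * v' 3 - v' 1 * v 3 ≠ 0 := by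
  intro hD
  have hD : (v 1 : ℝ) * v' 3 - v' 1 * v 3 = 0 := by exact_mod_cast hD
  rw [LinearIndependent.pair_iff] at hind
  obtain ⟨-, hv1⟩ := hind (v' 1) (-v 1) (by
    ext i; fin_cases i <;> simp [h0, h2, h0', h2'] <;> linarith)
  obtain ⟨-, hv3⟩ := hind (v' 3) (-v 3) (by
    ext i; fin_cases i <;> simp [h0, h2, h0', h2'] <;> linarith)
  have hv1 : v 1 = 0 := by simpa using hv1
  have hv3 : v 3 = 0 := by simpa using hv3
  refine one_ne_zero (hind 1 0 ?_).1
  ext i; fin_cases i <;> simp [h0, h2, hv1, hv3]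

/-- **Lower bound from two linearly independent small solutions.**
If v = (x₁,x₂,y₁,y₂) and v' = (x₁',x₂',y₁',y₂') are ℝ-linearly independent integer
vectors with |x₁|,|y₁|,|x₁'|,|y₁'| ≤ λH₁ < 1 and |x₂|,|y₂|,|x₂'|,|y₂'| ≤ λH₂,
satisfying z(a₁x₁+a₂x₂) = a₁y₁+a₂y₂ and z(a₁x₁'+a₂x₂') = a₁y₁'+a₂y₂' in F_p,
then 2λ²H₂² ≥ p. -/
theorem stmt9 (p : ℕ) (hp : p.Prime)
    (a₁ a₂ : ZMod p) (ha₂ : a₂ ≠ 0) (z : ZMod p)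
    (H₁ H₂ : ℕ) (hH₁ : 0 < H₁) (hH₂ : 0 < H₂)
    (lam : ℝ) (hlam : 0 < lam) (hlamH₁ : lam * H₁ < 1)
    (v v' : Fin 4 → ℤ)
    (hind : LinearIndependent ℝ ![fun i => ((v i : ℝ)), fun i => ((v' i : ℝ))])
    (hv0 : |(v 0 : ℝ)| ≤ lam * H₁) (hv2 : |(v 2 : ℝ)| ≤ lam * H₁)
    (hv1 : |(v 1 : ℝ)| ≤ lam * H₂) (hv3 : |(v 3 : ℝ)| ≤ lam * H₂)
    (hv'0 : |(v' 0 : ℝ)| ≤ lam * H₁) (hv'2 : |(v' 2 : ℝ)| ≤ lam * H₁)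
    (hv'1 : |(v' 1 : ℝ)| ≤ lam * H₂) (hv'3 : |(v' 3 : ℝ)| ≤ lam * H₂)
    (heq : z * (a₁ * (v 0 : ZMod p) + a₂ * (v 1 : ZMod p)) =
      a₁ * (v 2 : ZMod p) + a₂ * (v 3 : ZMod p))
    (heq' : z * (a₁ * (v' 0 : ZMod p) + a₂ * (v' 1 : ZMod p)) =
      a₁ * (v' 2 : ZMod p) + a₂ * (v' 3 : ZMod p)) :
    2 * lam ^ 2 * (H₂ : ℝ) ^ 2 ≥ p := by
  have h0 := Int.eq_zero_of_abs_cast_le_of_lt_one hv0 hlamH₁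
  have h2 := Int.eq_zero_of_abs_cast_le_of_lt_one hv2 hlamH₁
  have h0' := Int.eq_zero_of_abs_cast_le_of_lt_one hv'0 hlamH₁
  have h2' := Int.eq_zero_of_abs_cast_le_of_lt_one hv'2 hlamH₁
  have hD := det_ne_zero_of_linearIndependent_of_support hind h0 h2 h0' h2'
  have : Fact p.Prime := ⟨hp⟩
  simp only [h0, h2, h0', h2', Int.cast_zero, mul_zero, zero_add] at heq heq'
  have hdvd : (p : ℤ) ∣ v 1 * v' 3 - v' 1 * v 3 := by
    rw [← ZMod.intCast_zmod_eq_zero_iff_dvd]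
    push_cast
    refine (mul_eq_zero.mp ?_).resolve_left ha₂
    linear_combination (v' 1 : ZMod p) * heq - (v 1 : ZMod p) * heq'
  have hle : (p : ℝ) ≤ |(v 1 : ℝ) * v' 3 - v' 1 * v 3| := by
    exact_mod_cast Int.le_of_dvd (abs_pos.mpr hD) ((dvd_abs _ _).mpr hdvd)
  calc (p : ℝ) ≤ |(v 1 : ℝ) * v' 3 - v' 1 * v 3| := hle
    _ ≤ |(v 1 : ℝ)| * |(v' 3 : ℝ)| + |(v' 1 : ℝ)| * |(v 3 : ℝ)| := by
      simpa only [abs_mul] using abs_sub ((v 1 : ℝ) * v' 3) (v' 1 * v 3)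
    _ ≤ (lam * H₂) * (lam * H₂) + (lam * H₂) * (lam * H₂) := by gcongr
    _ = 2 * lam ^ 2 * (H₂ : ℝ) ^ 2 := by ring
end

section
/- Let p be prime, let a₁, a₂, z be integers with a₁ ≢ 0 and a₂ ≢ 0 (mod p), let H₁, H₂ be positive integers, and let 0 < λ < 1. Define Γ_z = {(x₁, x₂, y₁, y₂) ∈ ℤ⁴ : z(a₁x₁ + a₂x₂) ≡ a₁y₁ + a₂y₂ (mod p)}. Suppose (u₁, u₂, v₁, v₂) ∈ ℝ⁴ is a nonzero vector satisfying ⟨(u₁,u₂,v₁,v₂), w⟩ ∈ ℤ for all w ∈ Γ_z, and |u₁|, |v₁| ≤ λ/H₁ and |u₂|, |v₂| ≤ λ/H₂. Then there exists an integer t with t ≢ 0 (mod p) such that ‖a₁t/p‖ ≤ λ/H₁, ‖a₂t/p‖ ≤ λ/H₂, ‖za₁t/p‖ ≤ λ/H₁, and ‖za₂t/p‖ ≤ λ/H₂. -/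
open Finset

/-- Distance from a real number to the nearest integer. -/
noncomputable def distToInt (x : ℝ) : ℝ := |x - round x|

theorem distToInt_div_le_abs {p : ℕ} (hp : p ≠ 0) {m n : ℤ} (h : (p : ℤ) ∣ m - n) :
    distToInt ((m : ℝ) / p) ≤ |(n : ℝ) / p| := by
  obtain ⟨k, hk⟩ := h
  have hp' : (p : ℝ) ≠ 0 := by exact_mod_cast hp
  have hk' : (m : ℝ) - n = p * k := by exact_mod_cast hk
  have hmn : (n : ℝ) / p = (m : ℝ) / p - k := by
    field_simp
    linarith
  rw [hmn]
  exact round_le _ _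

theorem eq_zero_of_dvd_of_abs_div_lt_one {p : ℕ} (hp : p ≠ 0) {n : ℤ}
    (h : (p : ℤ) ∣ n) (hlt : |(n : ℝ) / p| < 1) : n = 0 := by
  refine Int.eq_zero_of_abs_lt_dvd h ?_
  have hp' : (0 : ℝ) < p := by exact_mod_cast Nat.pos_of_ne_zero hp
  rw [abs_div, abs_of_pos hp', div_lt_one hp'] at hlt
  exact_mod_cast hlt

/-- **Small dual vectors give elements of a Bohr set.**
If (u₁,u₂,v₁,v₂) ∈ ℝ⁴ is nonzero, has integer inner product with every element of
Γ_z, and satisfies |u₁|,|v₁| ≤ λ/H₁ and |u₂|,|v₂| ≤ λ/H₂ with 0 < λ < 1, then there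
is an integer t ≢ 0 (mod p) with ‖a₁t/p‖ ≤ λ/H₁, ‖a₂t/p‖ ≤ λ/H₂,
‖za₁t/p‖ ≤ λ/H₁ and ‖za₂t/p‖ ≤ λ/H₂. -/
theorem stmt10 (p : ℕ) (hp : p.Prime) (a₁ a₂ z : ℤ)
    (ha₁ : ¬ (p : ℤ) ∣ a₁) (ha₂ : ¬ (p : ℤ) ∣ a₂)
    (H₁ H₂ : ℕ) (hH₁ : 0 < H₁) (hH₂ : 0 < H₂)
    (lam : ℝ) (hlam0 : 0 < lam) (hlam1 : lam < 1)
    (v : Fin 4 → ℝ) (hv : v ≠ 0)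
    (hdual : ∀ w ∈ GammaZ p a₁ a₂ z, ∃ k : ℤ, (∑ i, v i * w i) = (k : ℝ))
    (hb0 : |v 0| ≤ lam / H₁) (hb1 : |v 1| ≤ lam / H₂)
    (hb2 : |v 2| ≤ lam / H₁) (hb3 : |v 3| ≤ lam / H₂) :
    ∃ t : ℤ, ¬ (p : ℤ) ∣ t ∧
      distToInt (((a₁ * t : ℤ) : ℝ) / p) ≤ lam / H₁ ∧
      distToInt (((a₂ * t : ℤ) : ℝ) / p) ≤ lam / H₂ ∧
      distToInt (((z * a₁ * t : ℤ) : ℝ) / p) ≤ lam / H₁ ∧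
      distToInt (((z * a₂ * t : ℤ) : ℝ) / p) ≤ lam / H₂ := by
  have hp0 : p ≠ 0 := hp.ne_zero
  have hpR : (p : ℝ) ≠ 0 := by exact_mod_cast hp0
  have hdual' : ∀ m : Fin 4 → ℤ, (p : ℤ) ∣ a₁ * m 2 + a₂ * m 3 - z * (a₁ * m 0 + a₂ * m 1) →
      ∃ k : ℤ, v 0 * m 0 + v 1 * m 1 + v 2 * m 2 + v 3 * m 3 = (k : ℝ) := by
    intro m hm
    obtain ⟨k, hk⟩ := hdual (fun i ↦ (m i : ℝ)) ⟨m, fun _ ↦ rfl, Int.modEq_iff_dvd.2 hm⟩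
    exact ⟨k, by rw [← hk, Fin.sum_univ_four]⟩
  have hdiv : ∀ i, ∃ n : ℤ, v i = (n : ℝ) / p := by
    intro i
    obtain ⟨n, hn⟩ := hdual (fun j ↦ ((Pi.single i (p : ℤ) : Fin 4 → ℤ) j : ℝ))
      ⟨Pi.single i (p : ℤ), fun _ ↦ rfl, by
        apply Int.modEq_iff_dvd.2
        have h (j : Fin 4) : (p : ℤ) ∣ (Pi.single i (p : ℤ) : Fin 4 → ℤ) j := by
          rw [Pi.single_apply]
          split_ifs <;> simp
        exact dvd_sub (dvd_add ((h 2).mul_left _) ((h 3).mul_left _))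
          ((dvd_add ((h 0).mul_left _) ((h 1).mul_left _)).mul_left _)⟩
    refine ⟨n, ?_⟩
    rw [eq_div_iff hpR, ← hn]
    simp [Pi.single_apply]
  choose n hn using hdiv
  have hdvd : ∀ m : Fin 4 → ℤ, (p : ℤ) ∣ a₁ * m 2 + a₂ * m 3 - z * (a₁ * m 0 + a₂ * m 1) →
      (p : ℤ) ∣ n 0 * m 0 + n 1 * m 1 + n 2 * m 2 + n 3 * m 3 := by
    intro m hm
    obtain ⟨k, hk⟩ := hdual' m hm
    refine ⟨k, ?_⟩
    simp only [hn] at hk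
    field_simp at hk
    exact_mod_cast hk
  have h23 : (p : ℤ) ∣ n 2 * a₂ - n 3 * a₁ := by
    have := hdvd ![0, 0, a₂, -a₁] ⟨0, by simp; ring⟩
    simpa [sub_eq_add_neg] using this
  have h02 : (p : ℤ) ∣ n 0 + n 2 * z := by
    have := hdvd ![1, 0, z, 0] ⟨0, by simp; ring⟩
    simpa using this
  have h13 : (p : ℤ) ∣ n 1 + n 3 * z := by
    have := hdvd ![0, 1, 0, z] ⟨0, by simp; ring⟩
    simpa using this
  have hpZ : Prime (p : ℤ) := Nat.prime_iff_prime_int.1 hp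
  obtain ⟨c, b, hb⟩ : IsCoprime (p : ℤ) a₁ := (hpZ.coprime_iff_not_dvd).2 ha₁
  have e2 : (p : ℤ) ∣ a₁ * (b * n 2) - n 2 := ⟨-c * n 2, by linear_combination n 2 * hb⟩
  have e3 : (p : ℤ) ∣ a₂ * (b * n 2) - n 3 := by
    obtain ⟨k, hk⟩ := h23
    exact ⟨b * k - c * n 3, by linear_combination b * hk + n 3 * hb⟩
  have e0 : (p : ℤ) ∣ z * a₁ * (b * n 2) - -n 0 := by
    have h : z * a₁ * (b * n 2) - -n 0 = z * (a₁ * (b * n 2) - n 2) + (n 0 + n 2 * z) := by ring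
    exact h ▸ dvd_add (e2.mul_left z) h02
  have e1 : (p : ℤ) ∣ z * a₂ * (b * n 2) - -n 1 := by
    have h : z * a₂ * (b * n 2) - -n 1 = z * (a₂ * (b * n 2) - n 3) + (n 1 + n 3 * z) := by ring
    exact h ▸ dvd_add (e3.mul_left z) h13
  have hneg (i : Fin 4) : |((-n i : ℤ) : ℝ) / p| = |v i| := by
    rw [hn i, Int.cast_neg, neg_div, abs_neg]
  have hlt (H : ℕ) (hH : 0 < H) : lam / H < 1 := by
    have : (1 : ℝ) ≤ H := by exact_mod_cast hH
    rw [div_lt_one (by linarith)]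
    linarith
  refine ⟨b * n 2, fun ht ↦ hv ?_, ?_, ?_, ?_, ?_⟩
  · have d2 : (p : ℤ) ∣ n 2 := (dvd_sub_right (ht.mul_left a₁)).1 e2
    have d3 : (p : ℤ) ∣ n 3 := (dvd_sub_right (ht.mul_left a₂)).1 e3
    have d0 : (p : ℤ) ∣ n 0 := (dvd_add_left (d2.mul_right z)).1 h02
    have d1 : (p : ℤ) ∣ n 1 := (dvd_add_left (d3.mul_right z)).1 h13
    have key (i : Fin 4) (hd : (p : ℤ) ∣ n i) (h : |v i| < 1) : v i = 0 := by
      rw [hn i] at h ⊢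
      simp [eq_zero_of_dvd_of_abs_div_lt_one hp0 hd h]
    ext i
    fin_cases i
    · exact key 0 d0 (hb0.trans_lt (hlt H₁ hH₁))
    · exact key 1 d1 (hb1.trans_lt (hlt H₂ hH₂))
    · exact key 2 d2 (hb2.trans_lt (hlt H₁ hH₁))
    · exact key 3 d3 (hb3.trans_lt (hlt H₂ hH₂))
  · exact (distToInt_div_le_abs hp0 e2).trans (hn 2 ▸ hb2)
  · exact (distToInt_div_le_abs hp0 e3).trans (hn 3 ▸ hb3)
  · exact (distToInt_div_le_abs hp0 e0).trans ((hneg 0).trans_le hb0)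
  · exact (distToInt_div_le_abs hp0 e1).trans ((hneg 1).trans_le hb1)
end

section
/- There is an absolute constant C > 0 such that the following holds. Let p be prime, let a₁, a₂ ∈ F_p ∖ {0}, and let H₁, H₂ be positive integers such that the symmetric GAP A = {a₁x₁ + a₂x₂ : x₁, x₂ ∈ ℤ, |x₁| ≤ H₁, |x₂| ≤ H₂} is proper, i.e. |A| = (2H₁+1)(2H₂+1). Let 0 < λ < 1 and let B = {x ∈ F_p : ‖a₁x/p‖ ≤ λ/H₁ and ‖a₂x/p‖ ≤ λ/H₂}. If B contains a nonzero element, then |B| ≤ C · λ · p / (H₁H₂). -/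
open Finset

/-- The integers of absolute value at most `R` number at most `2 * R + 1`. -/
lemma card_Icc_neg_floor_le {R : ℝ} (hR : 0 ≤ R) :
    ((Finset.Icc (-⌊R⌋) ⌊R⌋).card : ℝ) ≤ 2 * R + 1 := by
  have h0 : 0 ≤ ⌊R⌋ := Int.floor_nonneg.mpr hR
  have h1 : (((Finset.Icc (-⌊R⌋) ⌊R⌋).card : ℤ) : ℝ) = ((⌊R⌋ + 1 - -⌊R⌋ : ℤ) : ℝ) := by
    rw [Int.card_Icc, Int.toNat_of_nonneg (by omega)]
  have h2 := Int.floor_le R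
  push_cast at h1
  linarith

lemma mem_Icc_neg_floor {R : ℝ} {k : ℤ} (h : |(k : ℝ)| ≤ R) : k ∈ Finset.Icc (-⌊R⌋) ⌊R⌋ := by
  have h' : |k| ≤ ⌊R⌋ := Int.le_floor.mpr (by exact_mod_cast h)
  exact Finset.mem_Icc.mpr (abs_le.mp h')

/-- Points of a planar box, separated in the box norm by the norm `|w.1| / U` of `w` and whose
determinants against `w` are divisible by `p`, are few: at most `20 * U * V / p` plus a term for
those on a line parallel to `w`. -/
lemma card_le_of_dvd_det_of_separated {p : ℕ} (hp : 0 < p) {U V s : ℝ} (hU : 0 < U) (hV : 0 < V)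
    (S : Finset (ℤ × ℤ)) (w : ℤ × ℤ) (hw0 : w.1 ≠ 0) (hwU : |(w.1 : ℝ)| ≤ U)
    (hw : |(w.2 : ℝ)| * U ≤ |(w.1 : ℝ)| * V) (hs : U ≤ |(w.1 : ℝ)| * s)
    (hS1 : ∀ z ∈ S, |(z.1 : ℝ)| ≤ U) (hS2 : ∀ z ∈ S, |(z.2 : ℝ)| ≤ V)
    (hdvd : ∀ z ∈ S, (p : ℤ) ∣ z.1 * w.2 - z.2 * w.1)
    (hsep : ∀ z ∈ S, ∀ y ∈ S, z ≠ y →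
      |(w.1 : ℝ)| * V ≤ |((z.1 - y.1 : ℤ) : ℝ)| * V ∨
        |(w.1 : ℝ)| * V ≤ |((z.2 - y.2 : ℤ) : ℝ)| * U) :
    (S.card : ℝ) ≤ 20 * (U * V / p) + 5 * s := by
  have hpR : (0 : ℝ) < p := by exact_mod_cast hp
  set m : ℝ := |(w.1 : ℝ)| with hm
  have hm0 : 0 < m := abs_pos.mpr (by exact_mod_cast hw0)
  set R₁ : ℝ := 2 * V * m / p with hR₁
  set R₂ : ℝ := U / m + 1 with hR₂
  have hR₁0 : 0 ≤ R₁ := by positivity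
  have hR₂0 : 0 ≤ R₂ := by positivity
  let T := Finset.Icc (-⌊R₁⌋) ⌊R₁⌋ ×ˢ Finset.Icc (-⌊R₂⌋) ⌊R₂⌋
  let φ : ℤ × ℤ → ℤ × ℤ := fun z => ((z.1 * w.2 - z.2 * w.1) / p, ⌊(z.1 : ℝ) / m⌋)
  have hmaps : ∀ z ∈ S, φ z ∈ T := by
    intro z hz
    refine Finset.mem_product.mpr ⟨mem_Icc_neg_floor ?_, mem_Icc_neg_floor ?_⟩
    · obtain ⟨k, hk⟩ := hdvd z hz
      have hφ : (φ z).1 = k := by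
        simp only [φ, hk]
        exact Int.mul_ediv_cancel_left _ (by exact_mod_cast hp.ne')
      rw [hφ, hR₁, le_div_iff₀ hpR]
      have hk' : (k : ℝ) * p = z.1 * w.2 - z.2 * w.1 := by
        rw [mul_comm]; exact_mod_cast hk.symm
      have habs : |(k : ℝ)| * p = |(z.1 : ℝ) * w.2 - z.2 * w.1| := by
        rw [← hk', abs_mul, abs_of_pos hpR]
      rw [habs]
      have h1 := abs_sub ((z.1 : ℝ) * w.2) (z.2 * w.1)
      rw [abs_mul, abs_mul, ← hm] at h1
      have h2 := mul_le_mul_of_nonneg_right (hS1 z hz) (abs_nonneg (w.2 : ℝ))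
      have h3 := mul_le_mul_of_nonneg_right (hS2 z hz) hm0.le
      linarith
    · have hz1 : |(z.1 : ℝ) / m| ≤ U / m := by
        rw [abs_div, abs_of_pos hm0]
        exact div_le_div_of_nonneg_right (hS1 z hz) hm0.le
      have h1 := Int.floor_le ((z.1 : ℝ) / m)
      have h2 := Int.lt_floor_add_one ((z.1 : ℝ) / m)
      rw [abs_le] at hz1 ⊢
      constructor <;> simp only [φ, hR₂] <;> linarith
  have hinj : ∀ z ∈ S, ∀ y ∈ S, φ z = φ y → z = y := by
    intro z hz y hy h
    by_contra hne
    obtain ⟨h1, h2⟩ := Prod.mk.inj h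
    have hdet : z.1 * w.2 - z.2 * w.1 = y.1 * w.2 - y.2 * w.1 := by
      rw [← Int.ediv_mul_cancel (hdvd z hz), ← Int.ediv_mul_cancel (hdvd y hy), h1]
    have hlt : |((z.1 - y.1 : ℤ) : ℝ)| < m := by
      have h3 := Int.abs_sub_lt_one_of_floor_eq_floor h2
      rw [← sub_div, abs_div, abs_of_pos hm0, div_lt_one hm0] at h3
      push_cast
      exact h3
    have hpar : |((z.2 - y.2 : ℤ) : ℝ)| * m = |((z.1 - y.1 : ℤ) : ℝ)| * |(w.2 : ℝ)| := by
      rw [hm, ← abs_mul, ← abs_mul]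
      congr 1
      have : (z.2 - y.2) * w.1 = (z.1 - y.1) * w.2 := by linarith
      exact_mod_cast this
    rcases hsep z hz y hy hne with h3 | h3
    · exact absurd (le_of_mul_le_mul_right h3 hV) (not_le.mpr hlt)
    · have h4 : m * (m * V) ≤ |((z.1 - y.1 : ℤ) : ℝ)| * (m * V) := calc
        m * (m * V) ≤ m * (|((z.2 - y.2 : ℤ) : ℝ)| * U) := by gcongr
        _ = |((z.1 - y.1 : ℤ) : ℝ)| * (|(w.2 : ℝ)| * U) := by
          rw [← mul_assoc, mul_comm m, hpar, mul_assoc]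
        _ ≤ _ := by gcongr
      exact absurd (le_of_mul_le_mul_right h4 (by positivity)) (not_le.mpr hlt)
  have hcard : (S.card : ℝ) ≤ (2 * R₁ + 1) * (2 * R₂ + 1) := by
    have h1 : S.card ≤ T.card :=
      Finset.card_le_card_of_injOn φ hmaps (fun z hz y hy h => hinj z hz y hy h)
    calc (S.card : ℝ) ≤ T.card := by exact_mod_cast h1
      _ = _ := by rw [Finset.card_product, Nat.cast_mul]
      _ ≤ _ := mul_le_mul (card_Icc_neg_floor_le hR₁0) (card_Icc_neg_floor_le hR₂0)
          (by positivity) (by positivity)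
  have hUm : 1 ≤ U / m := (one_le_div hm0).mpr hwU
  have hUs : U / m ≤ s := by rw [div_le_iff₀ hm0]; linarith
  calc (S.card : ℝ) ≤ (2 * R₁ + 1) * (2 * R₂ + 1) := hcard
    _ ≤ (2 * R₁ + 1) * (5 * (U / m)) := by
      gcongr
      linarith
    _ = 20 * (U * V / p) + 5 * (U / m) := by
      rw [hR₁]; field_simp; ring
    _ ≤ _ := by linarith

/-- The representative of `y : ZMod p` nearest to `0`, as measured by `distToInt`. -/
lemma exists_int_cast_eq_abs_eq_distToInt {p : ℕ} (hp : 0 < p) (y : ZMod p) :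
    ∃ u : ℤ, (u : ZMod p) = y ∧ |(u : ℝ)| = p * distToInt ((y.val : ℝ) / p) := by
  have : NeZero p := ⟨hp.ne'⟩
  have hpR : (0 : ℝ) < p := by exact_mod_cast hp
  refine ⟨y.val - p * round ((y.val : ℝ) / p), by simp, ?_⟩
  rw [distToInt]
  nth_rewrite 2 [← abs_of_pos hpR]
  rw [← abs_mul]
  congr 1
  push_cast
  field_simp

/-- Properness of a symmetric rank 2 progression bounds below the nonzero relations. -/
lemma lt_abs_or_lt_abs_of_card_eq {p : ℕ} {a₁ a₂ : ZMod p} {H₁ H₂ : ℕ}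
    (hA : (((Finset.Icc (-(H₁ : ℤ)) H₁) ×ˢ (Finset.Icc (-(H₂ : ℤ)) H₂)).image
          (fun x => a₁ * (x.1 : ZMod p) + a₂ * (x.2 : ZMod p))).card
        = (2 * H₁ + 1) * (2 * H₂ + 1))
    {w : ℤ × ℤ} (hw : w ≠ 0) (hrel : a₁ * (w.2 : ZMod p) = a₂ * (w.1 : ZMod p)) :
    2 * (H₂ : ℤ) < |w.1| ∨ 2 * (H₁ : ℤ) < |w.2| := by
  have hinj := Finset.card_image_iff.mp (hA.trans (by
    have h (H : ℕ) : ((H : ℤ) + 1 - -(H : ℤ)).toNat = 2 * H + 1 := by omega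
    rw [Finset.card_product, Int.card_Icc, Int.card_Icc, h, h]))
  by_contra! hcon
  obtain ⟨h1, h2⟩ := hcon
  rw [abs_le] at h1 h2
  have key : (w.2 / 2, w.1 / 2 - w.1) = (w.2 / 2 - w.2, w.1 / 2) := by
    refine hinj ?_ ?_ ?_
    · simp only [Finset.coe_product, Finset.coe_Icc, Set.mem_prod, Set.mem_Icc]
      omega
    · simp only [Finset.coe_product, Finset.coe_Icc, Set.mem_prod, Set.mem_Icc]
      omega
    · push_cast
      linear_combination hrel
  obtain ⟨h3, h4⟩ := Prod.mk.inj key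
  exact hw (Prod.ext (by simp only [Prod.fst_zero]; omega) (by simp only [Prod.snd_zero]; omega))

/-- A finite set of points of the lattice `{z | a₁ * z.2 = a₂ * z.1}` in a box, containing `0`
and another point, has size at most `20 * U * V / p + 5 * s` if no nonzero lattice point lies
in the box scaled by `1 / s`. -/
lemma card_lattice_points_le {p : ℕ} (hp : 0 < p) {a₁ a₂ : ZMod p} {U V s : ℝ}
    (hU : 0 < U) (hV : 0 < V)
    (S : Finset (ℤ × ℤ)) (hS1 : ∀ z ∈ S, |(z.1 : ℝ)| ≤ U) (hS2 : ∀ z ∈ S, |(z.2 : ℝ)| ≤ V)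
    (hS : ∀ z ∈ S, ∃ x : ZMod p, (z.1 : ZMod p) = a₁ * x ∧ (z.2 : ZMod p) = a₂ * x)
    (hshort : ∀ w : ℤ × ℤ, w ≠ 0 → a₁ * (w.2 : ZMod p) = a₂ * (w.1 : ZMod p) →
      U ≤ |(w.1 : ℝ)| * s ∨ V ≤ |(w.2 : ℝ)| * s)
    {z₀ z₁ : ℤ × ℤ} (hz₀ : z₀ ∈ S) (hz₁ : z₁ ∈ S) (h0 : z₀ = 0) (h1 : z₁ ≠ 0) :
    (S.card : ℝ) ≤ 20 * (U * V / p) + 5 * s := by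
  let f : ℤ × ℤ → ℝ := fun z => max (|(z.1 : ℝ)| * V) (|(z.2 : ℝ)| * U)
  have hmem : (z₁, z₀) ∈ S.offDiag := Finset.mem_offDiag.mpr ⟨hz₁, hz₀, h0 ▸ h1⟩
  obtain ⟨⟨y, y'⟩, hy, hmin⟩ :=
    Finset.exists_min_image S.offDiag (fun q => f (q.1 - q.2)) ⟨_, hmem⟩
  obtain ⟨hyS, hyS', hne⟩ := Finset.mem_offDiag.mp hy
  set w : ℤ × ℤ := y - y' with hw
  have hw0 : w ≠ 0 := sub_ne_zero.mpr hne
  have hf1 : f w ≤ U * V := by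
    refine (hmin _ hmem).trans ?_
    simp only [h0, sub_zero, f]
    refine max_le ?_ ?_
    · have := hS1 _ hz₁
      gcongr
    · rw [mul_comm]
      have := hS2 _ hz₁
      gcongr
  have hrel : a₁ * (w.2 : ZMod p) = a₂ * (w.1 : ZMod p) := by
    obtain ⟨x, hx1, hx2⟩ := hS y hyS
    obtain ⟨x', hx1', hx2'⟩ := hS y' hyS'
    simp only [hw, Prod.fst_sub, Prod.snd_sub, Int.cast_sub, hx1, hx2, hx1', hx2']
    ring
  have hdvd : ∀ z ∈ S, (p : ℤ) ∣ z.1 * w.2 - z.2 * w.1 := by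
    intro z hz
    obtain ⟨x, hx1, hx2⟩ := hS z hz
    rw [← ZMod.intCast_zmod_eq_zero_iff_dvd]
    push_cast
    rw [hx1, hx2]
    linear_combination x * hrel
  have hsep : ∀ z ∈ S, ∀ z' ∈ S, z ≠ z' →
      f w ≤ |((z.1 - z'.1 : ℤ) : ℝ)| * V ∨ f w ≤ |((z.2 - z'.2 : ℤ) : ℝ)| * U :=
    fun z hz z' hz' hzz => le_max_iff.mp (hmin (z, z') (Finset.mem_offDiag.mpr ⟨hz, hz', hzz⟩))
  have hsh := hshort w hw0 hrel
  rcases le_total (|(w.2 : ℝ)| * U) (|(w.1 : ℝ)| * V) with hle | hle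
  · have hfw : f w = |(w.1 : ℝ)| * V := max_eq_left hle
    rw [hfw] at hsep hf1
    refine card_le_of_dvd_det_of_separated hp hU hV S w ?_ (le_of_mul_le_mul_right hf1 hV) hle ?_
      hS1 hS2 hdvd hsep
    · intro hz
      simp only [hz, Int.cast_zero, abs_zero, zero_mul] at hle
      have h3 : |(w.2 : ℝ)| = 0 :=
        le_antisymm (nonpos_of_mul_nonpos_left hle hU) (abs_nonneg _)
      exact hw0 (Prod.ext hz (by exact_mod_cast abs_eq_zero.mp h3))
    · rcases hsh with h | h
      · exact h
      · have hs : 0 ≤ s := (pos_of_mul_pos_right (hV.trans_le h) (abs_nonneg _)).le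
        refine le_of_mul_le_mul_right ?_ hV
        have h5 := mul_le_mul_of_nonneg_right hle hs
        have h6 := mul_le_mul_of_nonneg_right h hU.le
        linarith
  · have hfw : f w = |(w.2 : ℝ)| * U := max_eq_right hle
    rw [hfw] at hsep hf1
    have hswap : (S.card : ℝ) = ((S.map (Equiv.prodComm ℤ ℤ).toEmbedding).card : ℝ) := by
      rw [Finset.card_map]
    rw [hswap, mul_comm U V]
    have hmemS {z : ℤ × ℤ} (hz : z ∈ S.map (Equiv.prodComm ℤ ℤ).toEmbedding) : z.swap ∈ S := by
      obtain ⟨a, ha, rfl⟩ := Finset.mem_map.mp hz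
      simpa using ha
    refine card_le_of_dvd_det_of_separated hp hV hU _ w.swap ?_
      (le_of_mul_le_mul_right (hf1.trans_eq (mul_comm _ _)) hU) hle ?_
      (fun z hz => hS2 _ (hmemS hz)) (fun z hz => hS1 _ (hmemS hz))
      (fun z hz => ?_) (fun z hz z' hz' hzz => ?_)
    · intro hz
      simp only [Prod.fst_swap] at hz
      simp only [hz, Int.cast_zero, abs_zero, zero_mul] at hle
      have h3 : |(w.1 : ℝ)| = 0 :=
        le_antisymm (nonpos_of_mul_nonpos_left hle hV) (abs_nonneg _)
      exact hw0 (Prod.ext (by exact_mod_cast abs_eq_zero.mp h3) hz)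
    · simp only [Prod.fst_swap]
      rcases hsh with h | h
      · have hs : 0 ≤ s := (pos_of_mul_pos_right (hU.trans_le h) (abs_nonneg _)).le
        refine le_of_mul_le_mul_right ?_ hU
        have h5 := mul_le_mul_of_nonneg_right hle hs
        have h6 := mul_le_mul_of_nonneg_right h hV.le
        linarith
      · exact h
    · rw [← dvd_neg, neg_sub]
      exact hdvd _ (hmemS hz)
    · exact (hsep _ (hmemS hz) _ (hmemS hz') (fun h => hzz (Prod.swap_injective h))).symm

/-- **Bohr set bound for proper rank-2 GAP frequencies.**
There is an absolute constant C > 0 such that: for every prime p, a₁, a₂ ∈ F_p∖{0},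
positive integers H₁, H₂ with A = {a₁x₁ + a₂x₂ : |x₁| ≤ H₁, |x₂| ≤ H₂} proper,
and 0 < λ < 1, if the Bohr set B = {x : ‖a₁x/p‖ ≤ λ/H₁, ‖a₂x/p‖ ≤ λ/H₂} contains a
nonzero element, then |B| ≤ C·λ·p/(H₁H₂). -/
theorem stmt11 :
    ∃ C : ℝ, 0 < C ∧
      ∀ (p : ℕ), p.Prime →
      ∀ (a₁ a₂ : ZMod p), a₁ ≠ 0 → a₂ ≠ 0 →
      ∀ (H₁ H₂ : ℕ), 0 < H₁ → 0 < H₂ →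
      ∀ (A : Finset (ZMod p)),
        A = ((Finset.Icc (-(H₁ : ℤ)) H₁) ×ˢ (Finset.Icc (-(H₂ : ℤ)) H₂)).image
          (fun x => a₁ * (x.1 : ZMod p) + a₂ * (x.2 : ZMod p)) →
        A.card = (2 * H₁ + 1) * (2 * H₂ + 1) →
      ∀ (lam : ℝ), 0 < lam → lam < 1 →
      ∀ (B : Set (ZMod p)),
        B = {x : ZMod p | distToInt (((a₁ * x).val : ℝ) / p) ≤ lam / H₁ ∧
              distToInt (((a₂ * x).val : ℝ) / p) ≤ lam / H₂} →
        (∃ x ∈ B, x ≠ 0) →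
        (B.ncard : ℝ) ≤ C * lam * p / (H₁ * H₂) := by
  refine ⟨25, by norm_num, ?_⟩
  intro p hp a₁ a₂ ha₁ _ H₁ H₂ hH₁ hH₂ A hA hcard lam hlam hlam1 B hB ⟨x₁, hx₁, hx₁0⟩
  have : Fact p.Prime := ⟨hp⟩
  subst hA
  have hpR : (0 : ℝ) < p := by exact_mod_cast hp.pos
  have hH₁R : (0 : ℝ) < H₁ := by exact_mod_cast hH₁
  have hH₂R : (0 : ℝ) < H₂ := by exact_mod_cast hH₂
  choose r hr hrd using exists_int_cast_eq_abs_eq_distToInt (p := p) hp.pos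
  let g : ZMod p → ℤ × ℤ := fun x => (r (a₁ * x), r (a₂ * x))
  have hg : Function.Injective g := by
    intro x y h
    have h1 := congrArg (fun n : ℤ => (n : ZMod p)) (Prod.mk.inj h).1
    simp only [hr] at h1
    exact mul_left_cancel₀ ha₁ h1
  have hr0 : r 0 = 0 := by
    have := hrd 0
    simpa [distToInt] using this
  have hg0 : g 0 = 0 := by simp [g, hr0]
  have hBfin : B.Finite := Set.toFinite B
  have hb : ∀ x ∈ B, |(r (a₁ * x) : ℝ)| ≤ p * (lam / H₁) ∧
      |(r (a₂ * x) : ℝ)| ≤ p * (lam / H₂) := by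
    intro x hx
    rw [hB] at hx
    rw [hrd, hrd]
    exact ⟨mul_le_mul_of_nonneg_left hx.1 hpR.le, mul_le_mul_of_nonneg_left hx.2 hpR.le⟩
  have h0B : (0 : ZMod p) ∈ B := by
    rw [hB]
    simp only [Set.mem_ofPred_eq, mul_zero, ZMod.val_zero, Nat.cast_zero, zero_div, distToInt,
      round_zero, Int.cast_zero, sub_zero, abs_zero]
    constructor <;> positivity
  let S : Finset (ℤ × ℤ) := hBfin.toFinset.map ⟨g, hg⟩
  have hSmem : ∀ z ∈ S, ∃ x ∈ B, g x = z := by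
    intro z hz
    obtain ⟨x, hx, h⟩ := Finset.mem_map.mp hz
    exact ⟨x, hBfin.mem_toFinset.mp hx, h⟩
  have hgS : ∀ x ∈ B, g x ∈ S := fun x hx =>
    Finset.mem_map_of_mem ⟨g, hg⟩ (hBfin.mem_toFinset.mpr hx)
  set t : ℝ := lam * p / (H₁ * H₂) with ht
  have ht0 : 0 < t := by positivity
  have hU : (p : ℝ) * (lam / H₁) = t * H₂ := by rw [ht]; field_simp
  have hV : (p : ℝ) * (lam / H₂) = t * H₁ := by rw [ht]; field_simp
  have main : (S.card : ℝ) ≤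
      20 * (p * (lam / H₁) * (p * (lam / H₂)) / p) + 5 * t := by
    refine card_lattice_points_le (a₁ := a₁) (a₂ := a₂) hp.pos (by positivity) (by positivity) S
      ?_ ?_ ?_ ?_ (hgS 0 h0B) (hgS x₁ hx₁) hg0 (fun h => hx₁0 (hg (h.trans hg0.symm)))
    · intro z hz
      obtain ⟨x, hx, rfl⟩ := hSmem z hz
      exact (hb x hx).1
    · intro z hz
      obtain ⟨x, hx, rfl⟩ := hSmem z hz
      exact (hb x hx).2
    · intro z hz
      obtain ⟨x, -, rfl⟩ := hSmem z hz
      exact ⟨x, hr _, hr _⟩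
    · intro w hw hrel
      rw [hU, hV]
      refine (lt_abs_or_lt_abs_of_card_eq hcard hw hrel).imp (fun h => ?_) (fun h => ?_)
      · have h' : 2 * (H₂ : ℝ) < |(w.1 : ℝ)| := by exact_mod_cast h
        rw [mul_comm]
        gcongr
        linarith
      · have h' : 2 * (H₁ : ℝ) < |(w.2 : ℝ)| := by exact_mod_cast h
        rw [mul_comm]
        gcongr
        linarith
  have hSB : (B.ncard : ℝ) = S.card := by
    rw [Finset.card_map, Set.ncard_eq_toFinset_card B hBfin]
  have harea : (p : ℝ) * (lam / H₁) * (p * (lam / H₂)) / p = lam * t := by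
    rw [ht]; field_simp
  have hlt : lam * t ≤ t := mul_le_of_le_one_left ht0.le hlam1.le
  have hgoal : 25 * lam * p / (H₁ * H₂) = 25 * t := by rw [ht]; ring
  rw [hgoal, hSB]
  rw [harea] at main
  linarith
end
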